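/- Let N ≥ 2 and p ∈ (1, p_N). If 0 ≤ λ₁ < λ₂ and (α₁, ψ₁), (α₂, ψ₂) are solutions of problem (P)_{λ₁} and (P)_{λ₂} respectively on the unit-volume ball 𝔻_N, then α₁ > α₂ (the multiplier α_λ of the unique solution is strictly decreasing in λ). -/

import Mathlib

open MeasureTheory Metric Set

noncomputable section

/-- The Laplacian of a function on Euclidean space. -/
def lapl {N : ℕ} (f : EuclideanSpace ℝ (Fin N) → ℝ) (x : EuclideanSpace ℝ (Fin N)) : ℝ :=
  ∑ i : Fin N,
    fderiv ℝ (fun y => fderiv ℝ f y (EuclideanSpace.single i (1 : ℝ))) x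
      (EuclideanSpace.single i (1 : ℝ))

/-- `(α, ψ)` is a solution of problem `(P)_λ` on `Ω`:
`ψ ∈ C²`, `-Δψ = (max (α + λψ) 0)^p` in `Ω`, `ψ = 0` on `∂Ω`, and
`∫_Ω (max (α + λψ) 0)^p = 1`. -/
def IsSol {N : ℕ} (Ω : Set (EuclideanSpace ℝ (Fin N))) (p lam α : ℝ)
    (ψ : EuclideanSpace ℝ (Fin N) → ℝ) : Prop :=
  ContDiff ℝ 2 ψ ∧
  (∀ x ∈ Ω, -lapl ψ x = (max (α + lam * ψ x) 0) ^ p) ∧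
  (∀ x ∈ frontier Ω, ψ x = 0) ∧
  (∫ x in Ω, (max (α + lam * ψ x) 0) ^ p) = 1

/-- The radius `R_N` of the ball in `ℝ^N` centered at the origin with unit volume. -/
def RN (N : ℕ) : ℝ :=
  (volume (ball (0 : EuclideanSpace ℝ (Fin N)) 1)).toReal ^ (-(1 : ℝ) / (N : ℝ))

/-- `𝔻_N`: the open ball in `ℝ^N` centered at the origin with unit volume. -/
def DN (N : ℕ) : Set (EuclideanSpace ℝ (Fin N)) := ball 0 (RN N)

section Laplacian

open scoped Laplacian RealInnerProductSpace Topology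
open Filter Module

theorem hasDerivAt_nonneg_of_right {g : ℝ → ℝ} {g' : ℝ} (hg : HasDerivAt g g' 0)
    (h : ∀ᶠ t in 𝓝[>] (0 : ℝ), g 0 ≤ g t) : 0 ≤ g' := by
  refine ge_of_tendsto hg.tendsto_slope_zero_right ?_
  filter_upwards [h, self_mem_nhdsWithin] with t ht h0
  have h0 : (0 : ℝ) < t := h0
  simp only [zero_add, smul_eq_mul]
  exact mul_nonneg (inv_nonneg.2 h0.le) (sub_nonneg.2 ht)

variable {E : Type*} [NormedAddCommGroup E] [InnerProductSpace ℝ E]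

theorem hasDerivAt_comp_line {f : E → ℝ} (hf : ContDiff ℝ 2 f) (x v : E) (t : ℝ) :
    HasDerivAt (fun s : ℝ => f (x + s • v)) (fderiv ℝ f (x + t • v) v) t := by
  have h1 : HasDerivAt (fun s : ℝ => x + s • v) v t := by
    simpa using ((hasDerivAt_id t).smul_const v).const_add x
  exact ((hf.differentiable (by norm_num)) _).hasFDerivAt.comp_hasDerivAt t h1

theorem hasDerivAt_fderiv_comp {f : E → ℝ} (hf : ContDiff ℝ 2 f) {γ δ : ℝ → E} {γ' δ' : E} {t : ℝ}
    (hγ : HasDerivAt γ γ' t) (hδ : HasDerivAt δ δ' t) :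
    HasDerivAt (fun s : ℝ => fderiv ℝ f (γ s) (δ s))
      (fderiv ℝ (fderiv ℝ f) (γ t) γ' (δ t) + fderiv ℝ f (γ t) δ') t := by
  have h2 : ContDiff ℝ 1 (fderiv ℝ f) := hf.fderiv_right (by norm_num)
  have h3 := ((h2.differentiable (by norm_num)) (γ t)).hasFDerivAt.comp_hasDerivAt t hγ
  exact h3.clm_apply hδ

theorem hasDerivAt_fderiv_line {f : E → ℝ} (hf : ContDiff ℝ 2 f) (x v w : E) (t : ℝ) :
    HasDerivAt (fun s : ℝ => fderiv ℝ f (x + s • v) w)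
      (fderiv ℝ (fderiv ℝ f) (x + t • v) v w) t := by
  have h1 : HasDerivAt (fun s : ℝ => x + s • v) v t := by
    simpa using ((hasDerivAt_id t).smul_const v).const_add x
  simpa using hasDerivAt_fderiv_comp hf h1 (hasDerivAt_const t w)

/-- The second directional derivative is computed by differentiating twice along a line. -/
theorem fderiv_fderiv_eq_of_line {f : E → ℝ} (hf : ContDiff ℝ 2 f) {x v : E} {g : ℝ → ℝ} {c : ℝ}
    (hg : ∀ t, HasDerivAt (fun s : ℝ => f (x + s • v)) (g t) t) (hc : HasDerivAt g c 0) :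
    fderiv ℝ (fderiv ℝ f) x v v = c := by
  have h1 : (fun s : ℝ => fderiv ℝ f (x + s • v) v) = g :=
    funext fun t => (hasDerivAt_comp_line hf x v t).unique (hg t)
  have h2 := hasDerivAt_fderiv_line hf x v v 0
  rw [h1] at h2
  simpa using h2.unique hc

theorem fderiv_fderiv_nonneg_of_isLocalMin {f : E → ℝ} (hf : ContDiff ℝ 2 f) {x : E}
    (hx : IsLocalMin f x) (v : E) : 0 ≤ fderiv ℝ (fderiv ℝ f) x v v := by
  by_contra! hneg
  set g : ℝ → ℝ := fun s => f (x + s • v) with hg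
  have hd : deriv g = fun t => fderiv ℝ f (x + t • v) v :=
    funext fun t => (hasDerivAt_comp_line hf x v t).deriv
  have hdd : deriv (deriv g) 0 = fderiv ℝ (fderiv ℝ f) x v v := by
    rw [hd]; simpa using (hasDerivAt_fderiv_line hf x v v 0).deriv
  have hcont : ContinuousAt (fun s : ℝ => x + s • v) 0 := by fun_prop
  have hmin : IsLocalMin g 0 := by
    have : Tendsto (fun s : ℝ => x + s • v) (𝓝 0) (𝓝 x) := by
      simpa [ContinuousAt] using hcont
    have := this.eventually hx
    simpa [IsLocalMin, IsMinFilter, hg] using this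
  have hmax : IsLocalMax g 0 :=
    isLocalMax_of_deriv_deriv_neg (by rw [hdd]; exact hneg) hmin.deriv_eq_zero
      (hasDerivAt_comp_line hf x v 0).continuousAt
  have hconst : g =ᶠ[𝓝 0] fun _ => g 0 := by
    filter_upwards [hmin, hmax] with s h1 h2 using le_antisymm h2 h1
  have := hconst.deriv.deriv_eq
  rw [hdd] at this
  simp at this
  exact hneg.ne this


/-- The quadratic-in-`‖x - y‖²` barrier vanishing on the sphere of radius `ρ` about `y`. -/
def barrier (K ρ : ℝ) (y x : E) : ℝ :=
  (ρ ^ 2 - ‖x - y‖ ^ 2) + K * (ρ ^ 2 - ‖x - y‖ ^ 2) ^ 2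

theorem contDiff_barrier (K ρ : ℝ) (y : E) : ContDiff ℝ 2 (barrier K ρ y) := by
  unfold barrier
  have : ContDiff ℝ 2 fun x : E => ‖x - y‖ ^ 2 := (contDiff_id.sub contDiff_const).norm_sq ℝ
  fun_prop

theorem hasDerivAt_barrier_line (K ρ : ℝ) (y x v : E) (t : ℝ) :
    HasDerivAt (fun s : ℝ => barrier K ρ y (x + s • v))
      (-(2 * ⟪x - y, v⟫ + 2 * t * ‖v‖ ^ 2) *
        (1 + 2 * K * (ρ ^ 2 - (‖x - y‖ ^ 2 + 2 * t * ⟪x - y, v⟫ + t ^ 2 * ‖v‖ ^ 2)))) t := by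
  have h1 : ∀ s : ℝ, ‖x + s • v - y‖ ^ 2 = ‖x - y‖ ^ 2 + 2 * s * ⟪x - y, v⟫ + s ^ 2 * ‖v‖ ^ 2 := by
    intro s
    have : x + s • v - y = (x - y) + s • v := by abel
    rw [this, norm_add_sq_real, inner_smul_right, norm_smul, mul_pow, Real.norm_eq_abs, sq_abs]
    ring
  simp only [barrier, h1]
  have h2 : HasDerivAt (fun s : ℝ => ρ ^ 2 -
      (‖x - y‖ ^ 2 + 2 * s * ⟪x - y, v⟫ + s ^ 2 * ‖v‖ ^ 2))
      (-(2 * ⟪x - y, v⟫ + 2 * t * ‖v‖ ^ 2)) t := by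
    have := (((((hasDerivAt_id t).const_mul 2).mul_const ⟪x - y, v⟫).const_add (‖x - y‖ ^ 2)).add
      (((hasDerivAt_id t).pow 2).mul_const (‖v‖ ^ 2))).const_sub (ρ ^ 2)
    refine this.congr_deriv ?_
    simp
  refine (h2.add ((h2.pow 2).const_mul K)).congr_deriv ?_
  push_cast
  ring

variable [FiniteDimensional ℝ E]

theorem laplacian_eq_sum_fderiv {ι : Type*} [Fintype ι] (b : OrthonormalBasis ι ℝ E)
    (f : E → ℝ) (x : E) : Δ f x = ∑ i, fderiv ℝ (fderiv ℝ f) x (b i) (b i) := by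
  simp [InnerProductSpace.laplacian_eq_iteratedFDeriv_orthonormalBasis f b,
    iteratedFDeriv_two_apply]

theorem laplacian_nonneg_of_isLocalMin {f : E → ℝ} (hf : ContDiff ℝ 2 f) {x : E}
    (hx : IsLocalMin f x) : 0 ≤ Δ f x := by
  rw [laplacian_eq_sum_fderiv (stdOrthonormalBasis ℝ E)]
  exact Finset.sum_nonneg fun i _ => fderiv_fderiv_nonneg_of_isLocalMin hf hx _

theorem laplacian_sub_smul {f g : E → ℝ} (hf : ContDiff ℝ 2 f) (hg : ContDiff ℝ 2 g) (c : ℝ)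
    (x : E) : Δ (f - c • g) x = Δ f x - c * Δ g x := by
  have hcg : ContDiff ℝ 2 (c • g) := hg.const_smul c
  rw [hf.contDiffAt.laplacian_sub hcg.contDiffAt,
    InnerProductSpace.laplacian_smul _ hg.contDiffAt, smul_eq_mul]

theorem laplacian_comp_affine_isometry {f : E → ℝ} (hf : ContDiff ℝ 2 f) (S : E ≃ₗᵢ[ℝ] E)
    (c x : E) : Δ (fun y => f (S y + c)) x = Δ f (S x + c) := by
  set b := stdOrthonormalBasis ℝ E
  rw [laplacian_eq_sum_fderiv b, laplacian_eq_sum_fderiv (b.map S)]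
  refine Finset.sum_congr rfl fun i _ => ?_
  have hS : ContDiff ℝ 2 (fun y => f (S y + c)) :=
    hf.comp (S.contDiff.add contDiff_const)
  have key : ∀ s : ℝ, S (x + s • b i) + c = (S x + c) + s • S (b i) := fun s => by
    rw [map_add, map_smul]; abel
  refine fderiv_fderiv_eq_of_line hS (g := fun t => fderiv ℝ f ((S x + c) + t • S (b i)) (S (b i)))
    (fun t => ?_) ?_
  · simp only [key]
    exact hasDerivAt_comp_line hf _ _ t
  · simpa using hasDerivAt_fderiv_line hf (S x + c) (S (b i)) (S (b i)) 0

theorem laplacian_barrier (K ρ : ℝ) (y x : E) :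
    Δ (barrier K ρ y) x = -2 * finrank ℝ E + 8 * K * ‖x - y‖ ^ 2
      - 4 * finrank ℝ E * K * (ρ ^ 2 - ‖x - y‖ ^ 2) := by
  set b := stdOrthonormalBasis ℝ E
  rw [laplacian_eq_sum_fderiv b]
  have h : ∀ i, fderiv ℝ (fderiv ℝ (barrier K ρ y)) x (b i) (b i) =
      (-2 - 4 * K * (ρ ^ 2 - ‖x - y‖ ^ 2)) + 8 * K * ⟪b i, x - y⟫ ^ 2 := by
    intro i
    refine fderiv_fderiv_eq_of_line (contDiff_barrier K ρ y)
      (fun t => hasDerivAt_barrier_line K ρ y x (b i) t) ?_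
    have hb : ‖b i‖ = 1 := b.orthonormal.1 i
    rw [real_inner_comm (x - y) (b i), hb]
    set c := ⟪x - y, b i⟫
    have h1 : HasDerivAt (fun t : ℝ => -(2 * c + 2 * t * 1 ^ 2)) (-2) 0 := by
      refine ((((hasDerivAt_id (0 : ℝ)).const_mul 2).mul_const (1 ^ 2 : ℝ)).const_add
        (2 * c)).neg.congr_deriv ?_
      norm_num
    have h2 : HasDerivAt (fun t : ℝ => 1 + 2 * K * (ρ ^ 2 - (‖x - y‖ ^ 2 + 2 * t * c +
        t ^ 2 * 1 ^ 2))) (2 * K * (-(2 * c))) 0 := by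
      have := (((((((hasDerivAt_id (0 : ℝ)).const_mul 2).mul_const c).const_add
        (‖x - y‖ ^ 2)).add (((hasDerivAt_id (0 : ℝ)).pow 2).mul_const (1 ^ 2 : ℝ))).const_sub
        (ρ ^ 2)).const_mul (2 * K)).const_add 1
      refine this.congr_deriv ?_
      simp
    refine (h1.mul h2).congr_deriv ?_
    ring
  simp only [h, Finset.sum_add_distrib, ← Finset.mul_sum, Finset.sum_const, Finset.card_univ,
    Fintype.card_fin, nsmul_eq_mul]
  rw [b.sum_sq_inner_right]
  ring

/-- Hopf's boundary point lemma on a ball. -/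
theorem hopf_boundary_lemma {v : E → ℝ} (hv : ContDiff ℝ 2 v) {y x₀ d : E} {ρ : ℝ} (hρ : 0 < ρ)
    (hsup : ∀ x ∈ ball y ρ, Δ v x ≤ 0) (hpos : ∀ x ∈ ball y ρ, 0 < v x)
    (hx₀ : ‖x₀ - y‖ = ρ) (hv₀ : v x₀ = 0) (hd : 0 < ⟪d, y - x₀⟫) :
    0 < fderiv ℝ v x₀ d := by
  set n : ℝ := (finrank ℝ E : ℝ) with hn
  have hn0 : 0 ≤ n := Nat.cast_nonneg _
  set K : ℝ := (n + 1) / ρ ^ 2 with hK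
  have hK0 : 0 < K := by positivity
  have hKρ : K * ρ ^ 2 = n + 1 := by rw [hK]; field_simp
  set θ : ℝ := (n + 1) / (n + 2) with hθ
  have hθ1 : θ < 1 := by rw [hθ, div_lt_one (by positivity)]; linarith
  have hθ0 : 0 < θ := by positivity
  have hball : ∀ x, ‖x - y‖ ^ 2 < ρ ^ 2 → x ∈ ball y ρ := fun x hx => by
    rw [mem_ball, dist_eq_norm]; exact lt_of_pow_lt_pow_left₀ 2 hρ.le hx
  set s : Set E := {x | ‖x - y‖ ^ 2 ≤ θ * ρ ^ 2} with hs
  have hsb : s ⊆ ball y ρ := fun x hx => hball x (lt_of_le_of_lt hx (by nlinarith [sq_pos_of_pos hρ]))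
  have hsc : IsCompact s := by
    refine (isCompact_closedBall y ρ).of_isClosed_subset ?_ (hsb.trans ball_subset_closedBall)
    exact isClosed_le (by fun_prop) continuous_const
  have hyS : y ∈ s := by
    change ‖y - y‖ ^ 2 ≤ θ * ρ ^ 2
    rw [sub_self, norm_zero]; nlinarith [mul_pos hθ0 (pow_pos hρ 2)]
  obtain ⟨z, hzs, hz⟩ := hsc.exists_isMinOn ⟨y, hyS⟩ hv.continuous.continuousOn
  have hm : 0 < v z := hpos z (hsb hzs)
  set H : ℝ := ρ ^ 2 + K * (ρ ^ 2) ^ 2 with hH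
  have hH0 : 0 < H := by positivity
  set ε : ℝ := v z / H with hε
  have hε0 : 0 < ε := by positivity
  have hεH : ε * H = v z := by rw [hε]; field_simp
  set f : E → ℝ := v - ε • barrier K ρ y with hf
  have hfC : ContDiff ℝ 2 f := hv.sub ((contDiff_barrier K ρ y).const_smul ε)
  have hfx : ∀ x, f x = v x - ε * barrier K ρ y x := fun x => by simp [hf]
  have hvnn : ∀ x ∈ closedBall y ρ, 0 ≤ v x := by
    rw [← closure_ball y hρ.ne']
    exact fun x hx => closure_minimal (s := ball y ρ) (t := {x | 0 ≤ v x})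
      (fun x hx => (hpos x hx).le) (isClosed_le continuous_const hv.continuous) hx
  have hfnn : ∀ x ∈ closedBall y ρ, 0 ≤ f x := by
    obtain ⟨w, hwb, hw⟩ := (isCompact_closedBall y ρ).exists_isMinOn
      ⟨y, mem_closedBall_self hρ.le⟩ hfC.continuous.continuousOn
    suffices h : 0 ≤ f w from fun x hx => h.trans (hw hx)
    by_contra! hneg
    have hwρ : ‖w - y‖ ≤ ρ := by rwa [mem_closedBall, dist_eq_norm] at hwb
    have hwlt : ‖w - y‖ < ρ := by
      refine lt_of_le_of_ne hwρ fun heq => ?_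
      rw [hfx] at hneg
      have := hvnn w hwb
      simp [barrier, heq] at hneg
      linarith
    have hws : θ * ρ ^ 2 < ‖w - y‖ ^ 2 := by
      by_contra! hle
      have h1 : v z ≤ v w := hz hle
      have h2 : barrier K ρ y w ≤ H := by
        have hq0 : 0 ≤ ‖w - y‖ ^ 2 := by positivity
        have hq1 : ‖w - y‖ ^ 2 ≤ ρ ^ 2 := by gcongr
        unfold barrier
        rw [hH]
        gcongr <;> linarith
      rw [hfx] at hneg
      nlinarith
    have hwball : w ∈ ball y ρ := by rwa [mem_ball, dist_eq_norm]
    have hloc : IsLocalMin f w := hw.isLocalMin (mem_nhds_iff.2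
      ⟨ball y ρ, ball_subset_closedBall, isOpen_ball, hwball⟩)
    have h1 := laplacian_nonneg_of_isLocalMin hfC hloc
    have h2 : Δ f w = Δ v w - ε * Δ (barrier K ρ y) w :=
      laplacian_sub_smul hv (contDiff_barrier K ρ y) ε w
    have h3 := hsup w hwball
    have h4 : 0 < Δ (barrier K ρ y) w := by
      rw [laplacian_barrier, ← hn]
      set q := ‖w - y‖ ^ 2
      have h5 : K * (θ * ρ ^ 2) < K * q := by gcongr
      have h6 : K * (θ * ρ ^ 2) * (n + 2) = (n + 1) ^ 2 := by
        have : K * (θ * ρ ^ 2) = K * ρ ^ 2 * θ := by ring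
        rw [this, hKρ, hθ]; field_simp
      have h7 : 4 * n * K * (ρ ^ 2 - q) = 4 * n * (n + 1) - 4 * n * (K * q) := by
        rw [← hKρ]; ring
      rw [h7]
      nlinarith
    nlinarith
  have hder : HasDerivAt (fun s : ℝ => f (x₀ + s • d)) (fderiv ℝ v x₀ d - ε * (2 * ⟪d, y - x₀⟫)) 0 := by
    have h1 := (hasDerivAt_comp_line hv x₀ d 0).sub
      ((hasDerivAt_barrier_line K ρ y x₀ d 0).const_mul ε)
    simp only [hfx]
    refine h1.congr_deriv ?_
    have : ⟪x₀ - y, d⟫ = - ⟪d, y - x₀⟫ := by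
      rw [real_inner_comm, ← inner_neg_right, neg_sub]
    rw [zero_smul, add_zero, hx₀, this]
    ring
  have hfin : 0 ≤ fderiv ℝ v x₀ d - ε * (2 * ⟪d, y - x₀⟫) := by
    refine hasDerivAt_nonneg_of_right hder ?_
    have h0 : f (x₀ + (0 : ℝ) • d) = 0 := by simp [hfx, hv₀, barrier, hx₀]
    simp only [h0]
    have hev : ∀ᶠ t in 𝓝 (0 : ℝ), t * ‖d‖ ^ 2 < 2 * ⟪d, y - x₀⟫ := by
      have : ContinuousAt (fun t : ℝ => t * ‖d‖ ^ 2) 0 := by fun_prop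
      exact this.eventually_lt continuousAt_const (by simpa using hd)
    filter_upwards [nhdsWithin_le_nhds hev, self_mem_nhdsWithin] with t ht h0
    have h0 : (0 : ℝ) < t := h0
    refine hfnn _ ?_
    rw [mem_closedBall, dist_eq_norm]
    refine le_of_sq_le_sq ?_ hρ.le
    have e1 : x₀ + t • d - y = (x₀ - y) + t • d := by abel
    have e2 : ⟪x₀ - y, d⟫ = - ⟪d, y - x₀⟫ := by
      rw [real_inner_comm, ← inner_neg_right, neg_sub]
    rw [e1, norm_add_sq_real, inner_smul_right, norm_smul, mul_pow, Real.norm_eq_abs, sq_abs, hx₀, e2]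
    nlinarith
  nlinarith [mul_pos hε0 hd]

end Laplacian

section MaximumPrinciple

open scoped Laplacian RealInnerProductSpace Topology
open Filter Module

variable {E : Type*} [NormedAddCommGroup E] [InnerProductSpace ℝ E] [FiniteDimensional ℝ E]

/-- Strong minimum principle for nonnegative superharmonic functions. -/
theorem pos_of_superharmonic {v : E → ℝ} (hv : ContDiff ℝ 2 v) {C : Set E} (hC : IsOpen C)
    (hconn : IsPreconnected C) (hsup : ∀ x ∈ C, Δ v x ≤ 0) (hnn : ∀ x ∈ C, 0 ≤ v x)
    {z : E} (hz : z ∈ C) (hvz : 0 < v z) : ∀ x ∈ C, 0 < v x := by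
  have hopenpos : IsOpen (C ∩ {x | 0 < v x}) :=
    hC.inter (isOpen_lt continuous_const hv.continuous)
  have hopenzero : IsOpen (C ∩ {x | v x = 0}) := by
    rw [Metric.isOpen_iff]
    rintro x ⟨hxC, hx0⟩
    obtain ⟨r, hr, hrC⟩ := Metric.isOpen_iff.1 hC x hxC
    refine ⟨r / 4, by positivity, fun w hw => ?_⟩
    have hwx : dist w x < r / 4 := hw
    have hwC : w ∈ C := hrC (by rw [mem_ball]; linarith)
    refine ⟨hwC, ?_⟩
    by_contra hne
    have hvw : 0 < v w := lt_of_le_of_ne (hnn w hwC) (Ne.symm hne)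
    have hcpt : IsCompact (closedBall w (r / 2) ∩ {x | v x = 0}) :=
      (isCompact_closedBall _ _).inter_right (isClosed_eq hv.continuous continuous_const)
    have hxm : x ∈ closedBall w (r / 2) ∩ {x | v x = 0} :=
      ⟨by rw [mem_closedBall, dist_comm]; linarith, hx0⟩
    obtain ⟨x₀, ⟨hx₀b, hx₀z⟩, hmin⟩ := hcpt.exists_isMinOn ⟨x, hxm⟩
      (f := fun a => dist a w) (by fun_prop)
    have hle : dist x₀ w ≤ dist x w := hmin hxm
    rw [dist_comm x w] at hle
    have hx₀z : v x₀ = 0 := hx₀z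
    have hρ : 0 < dist x₀ w := dist_pos.2 fun h => by rw [h] at hx₀z; exact hne hx₀z
    have hsub : ball w (dist x₀ w) ⊆ C := fun a ha => hrC <| by
      rw [mem_ball] at ha ⊢
      linarith [dist_triangle a w x]
    have hx₀C : x₀ ∈ C := hrC <| by
      rw [mem_ball]; linarith [dist_triangle x₀ w x]
    have hposb : ∀ a ∈ ball w (dist x₀ w), 0 < v a := fun a ha => by
      refine lt_of_le_of_ne (hnn a (hsub ha)) fun h => ?_
      rw [mem_ball] at ha
      have : dist x₀ w ≤ dist a w := hmin ⟨by rw [mem_closedBall]; linarith, h.symm⟩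
      linarith
    have hopf := hopf_boundary_lemma hv (d := w - x₀) hρ (fun a ha => hsup a (hsub ha)) hposb
      (dist_eq_norm x₀ w).symm hx₀z (by
        rw [real_inner_self_eq_norm_sq, ← dist_eq_norm, dist_comm]; positivity)
    have hloc : IsLocalMin v x₀ := by
      filter_upwards [hC.mem_nhds hx₀C] with a ha
      rw [hx₀z]; exact hnn a ha
    rw [hloc.fderiv_eq_zero] at hopf
    simp at hopf
  by_contra! hcon
  obtain ⟨x, hxC, hx⟩ := hcon
  obtain ⟨a, haC, ⟨-, ha1⟩, -, ha2⟩ := hconn _ _ hopenpos hopenzero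
    (fun a ha => (hnn a ha).lt_or_eq.imp (fun h => ⟨ha, h⟩) (fun h => ⟨ha, h.symm⟩))
    ⟨z, hz, hz, hvz⟩ ⟨x, hxC, hxC, le_antisymm hx (hnn x hxC)⟩
  exact ha1.ne' ha2

/-- Weak minimum principle on a ball. -/
theorem nonneg_of_superharmonic [Nontrivial E] {v : E → ℝ} (hv : ContDiff ℝ 2 v) {R : ℝ}
    (hR : 0 < R) (hsup : ∀ x ∈ ball (0 : E) R, Δ v x ≤ 0) (hbd : ∀ x : E, ‖x‖ = R → v x = 0) :
    ∀ x ∈ closedBall (0 : E) R, 0 ≤ v x := by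
  intro x hx
  by_contra! hneg
  set ε : ℝ := -(v x / (2 * R ^ 2)) with hε
  have hε0 : 0 < ε := by
    rw [hε, Left.neg_pos_iff]; exact div_neg_of_neg_of_pos hneg (by positivity)
  have hεR : ε * R ^ 2 = -(v x / 2) := by rw [hε]; field_simp
  set f : E → ℝ := v - (-ε) • barrier 0 R 0 with hf
  have hfC : ContDiff ℝ 2 f := hv.sub ((contDiff_barrier 0 R 0).const_smul (-ε))
  have hfx : ∀ x, f x = v x + ε * (R ^ 2 - ‖x‖ ^ 2) := fun x => by simp [hf, barrier]
  obtain ⟨w, hwb, hw⟩ := (isCompact_closedBall (0 : E) R).exists_isMinOn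
    ⟨0, mem_closedBall_self hR.le⟩ hfC.continuous.continuousOn
  have hwR : ‖w‖ ≤ R := by simpa using hwb
  have hfw : f w < 0 := by
    have h1 : f w ≤ f x := hw hx
    rw [hfx x] at h1
    nlinarith [sq_nonneg ‖x‖]
  have hwlt : ‖w‖ < R := by
    refine lt_of_le_of_ne hwR fun heq => ?_
    rw [hfx, hbd w heq, heq] at hfw
    simp at hfw
  have hwball : w ∈ ball (0 : E) R := by simpa using hwlt
  have hloc : IsLocalMin f w := hw.isLocalMin (mem_nhds_iff.2
    ⟨ball 0 R, ball_subset_closedBall, isOpen_ball, hwball⟩)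
  have h1 := laplacian_nonneg_of_isLocalMin hfC hloc
  rw [hf, laplacian_sub_smul hv (contDiff_barrier 0 R 0), laplacian_barrier] at h1
  have h3 := hsup w hwball
  have h4 : (0 : ℝ) < finrank ℝ E := by exact_mod_cast finrank_pos
  nlinarith

end MaximumPrinciple

section MovingPlanes

open scoped Laplacian RealInnerProductSpace Topology
open Filter Module

variable {E : Type*} [NormedAddCommGroup E] [InnerProductSpace ℝ E]

/-- Reflection across the hyperplane `⟪x, e⟫ = μ`, for a unit vector `e`. -/
def planeReflection (e : E) (μ : ℝ) (x : E) : E := x - (2 * (⟪x, e⟫ - μ)) • e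

theorem norm_sq_planeReflection {e : E} (he : ‖e‖ = 1) (μ : ℝ) (x : E) :
    ‖planeReflection e μ x‖ ^ 2 = ‖x‖ ^ 2 - 4 * μ * (⟪x, e⟫ - μ) := by
  rw [planeReflection, norm_sub_sq_real, inner_smul_right, norm_smul, he, mul_one,
    Real.norm_eq_abs, sq_abs]
  ring

theorem norm_planeReflection_lt {e : E} (he : ‖e‖ = 1) {μ R : ℝ} (hμ : 0 < μ) {x : E}
    (hx : ‖x‖ ≤ R) (hxμ : μ < ⟪x, e⟫) : ‖planeReflection e μ x‖ < R := by
  refine lt_of_lt_of_le (lt_of_pow_lt_pow_left₀ 2 (norm_nonneg x) ?_) hx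
  rw [norm_sq_planeReflection he]
  nlinarith [mul_pos hμ (sub_pos.2 hxμ)]

theorem continuous_planeReflection (e : E) :
    Continuous fun q : ℝ × E => planeReflection e q.1 q.2 := by
  unfold planeReflection
  fun_prop

theorem planeReflection_eq_reflection {e : E} (he : ‖e‖ = 1) (μ : ℝ) (x : E) :
    planeReflection e μ x = (ℝ ∙ e)ᗮ.reflection x + (2 * μ) • e := by
  rw [Submodule.reflection_orthogonal_apply, Submodule.reflection_singleton_apply, he,
    planeReflection, real_inner_comm]
  simp only [RCLike.ofReal_real_eq_id, id_eq, one_pow, div_one]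
  module

theorem contDiff_comp_planeReflection {u : E → ℝ} (hu : ContDiff ℝ 2 u) (e : E) (μ : ℝ) :
    ContDiff ℝ 2 fun x => u (planeReflection e μ x) := by
  refine hu.comp ?_
  unfold planeReflection
  have h : ContDiff ℝ 2 fun x : E => ⟪x, e⟫ := contDiff_id.inner ℝ contDiff_const
  exact contDiff_id.sub ((contDiff_const.mul (h.sub contDiff_const)).smul contDiff_const)

theorem exists_fderiv_pos_of_planeReflection_lt {u : E → ℝ} (hu : ContDiff ℝ 2 u) {e : E} {μ : ℝ}
    {x : E} (hxμ : μ < ⟪x, e⟫) (hlt : u (planeReflection e μ x) < u x) :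
    ∃ s ∈ Ioo (-(2 * (⟪x, e⟫ - μ))) 0, 0 < fderiv ℝ u (x + s • e) e := by
  have hneg : -(2 * (⟪x, e⟫ - μ)) < 0 := by linarith
  obtain ⟨s, hs, hslope⟩ := exists_hasDerivAt_eq_slope (fun s : ℝ => u (x + s • e))
    (fun s => fderiv ℝ u (x + s • e) e) hneg
    (hu.continuous.comp (by fun_prop)).continuousOn
    (fun s _ => hasDerivAt_comp_line hu x e s)
  refine ⟨s, hs, ?_⟩
  rw [hslope]
  refine div_pos ?_ (by linarith)
  have : planeReflection e μ x = x + (-(2 * (⟪x, e⟫ - μ))) • e := by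
    rw [planeReflection]; module
  rw [← this, zero_smul, add_zero]
  linarith

variable [FiniteDimensional ℝ E]

theorem laplacian_comp_planeReflection {u : E → ℝ} (hu : ContDiff ℝ 2 u) {e : E} (he : ‖e‖ = 1)
    (μ : ℝ) (x : E) :
    Δ (fun x => u (planeReflection e μ x)) x = Δ u (planeReflection e μ x) := by
  simp only [planeReflection_eq_reflection he]
  exact laplacian_comp_affine_isometry hu _ _ _

/-- In a cap where `u` does not exceed its reflection, the inequality is strict. -/
theorem lt_comp_planeReflection_of_le {u : E → ℝ} (hu : ContDiff ℝ 2 u) {R : ℝ}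
    {g : ℝ → ℝ} (hg : Monotone g)
    (heq : ∀ x ∈ ball (0 : E) R, -Δ u x = g (u x)) (hbd : ∀ x : E, ‖x‖ = R → u x = 0)
    (hpos : ∀ x ∈ ball (0 : E) R, 0 < u x) {e : E} (he : ‖e‖ = 1) {μ : ℝ} (hμ : 0 < μ)
    (hμR : μ < R)
    (hle : ∀ x ∈ closedBall (0 : E) R, ⟪x, e⟫ ≤ μ ∨ u x ≤ u (planeReflection e μ x))
    {x : E} (hx : ‖x‖ < R) (hxμ : μ < ⟪x, e⟫) : u x < u (planeReflection e μ x) := by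
  set w : E → ℝ := (fun x => u (planeReflection e μ x)) - (1 : ℝ) • u with hw
  have hwx : ∀ x, w x = u (planeReflection e μ x) - u x := fun x => by simp [hw]
  have hr := contDiff_comp_planeReflection hu e μ
  have hwC : ContDiff ℝ 2 w := hr.sub (hu.const_smul (1 : ℝ))
  have hR : 0 < R := hμ.trans hμR
  set C : Set E := ball 0 R ∩ {x | μ < ⟪x, e⟫} with hC
  have hCo : IsOpen C := isOpen_ball.inter (isOpen_lt continuous_const (by fun_prop))
  have hlin : IsLinearMap ℝ fun x : E => ⟪x, e⟫ :=
    ⟨fun a b => inner_add_left _ _ _, fun a b => real_inner_smul_left _ _ _⟩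
  have hCc : IsPreconnected C :=
    ((convex_ball _ _).inter (convex_halfSpace_gt hlin μ)).isPreconnected
  have hle' : ∀ a ∈ C, u a ≤ u (planeReflection e μ a) := fun a ha =>
    (hle a (ball_subset_closedBall ha.1)).resolve_left (not_le.2 ha.2)
  have hsup : ∀ a ∈ C, Δ w a ≤ 0 := by
    intro a ha
    have ha1 : ‖a‖ < R := by simpa using ha.1
    rw [hw, laplacian_sub_smul hr hu, laplacian_comp_planeReflection hu he]
    have h1 := heq a ha.1
    have h2 := heq (planeReflection e μ a) (by
      simpa using norm_planeReflection_lt he hμ ha1.le ha.2)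
    have h3 := hg (hle' a ha)
    linarith
  have hnn : ∀ a ∈ C, 0 ≤ w a := fun a ha => by rw [hwx]; linarith [hle' a ha]
  have hz : ∃ z ∈ C, 0 < w z := by
    have hRe : ⟪R • e, e⟫ = R := by
      rw [real_inner_smul_left, real_inner_self_eq_norm_sq, he]; ring
    have hnR : ‖R • e‖ = R := by rw [norm_smul, he, mul_one, Real.norm_of_nonneg hR.le]
    have h1 : 0 < w (R • e) := by
      rw [hwx, hbd _ hnR, sub_zero]
      refine hpos _ ?_
      simpa using norm_planeReflection_lt he hμ hnR.le (by rw [hRe]; exact hμR)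
    have h2 : ∀ᶠ t : ℝ in 𝓝 R, 0 < w (t • e) :=
      continuousAt_const.eventually_lt
        (f := fun _ => (0 : ℝ)) (g := fun t : ℝ => w (t • e))
        (hwC.continuous.comp (by fun_prop)).continuousAt h1
    have h3 : ∀ᶠ t : ℝ in 𝓝[<] R, 0 < w (t • e) := nhdsWithin_le_nhds h2
    obtain ⟨t, ht1, htμ, htR⟩ := (h3.and (Ioo_mem_nhdsLT hμR)).exists
    have ht0 : 0 < t := hμ.trans htμ
    refine ⟨t • e, ⟨?_, ?_⟩, ht1⟩
    · rw [mem_ball_zero_iff, norm_smul, he, mul_one, Real.norm_of_nonneg ht0.le]; exact htR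
    · change μ < ⟪t • e, e⟫
      rw [real_inner_smul_left, real_inner_self_eq_norm_sq, he]; linarith
  obtain ⟨z, hzC, hz⟩ := hz
  have := pos_of_superharmonic hwC hCo hCc hsup hnn hzC hz x ⟨by simpa using hx, hxμ⟩
  rw [hwx] at this
  linarith

/-- At points of the reflecting hyperplane, `u` is strictly decreasing in the direction `e`. -/
theorem fderiv_neg_of_le_planeReflection {u : E → ℝ} (hu : ContDiff ℝ 2 u) {R : ℝ}
    {g : ℝ → ℝ} (hg : Monotone g) (hg0 : ∀ t, 0 ≤ g t)
    (heq : ∀ x ∈ ball (0 : E) R, -Δ u x = g (u x)) (hbd : ∀ x : E, ‖x‖ = R → u x = 0)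
    (hpos : ∀ x ∈ ball (0 : E) R, 0 < u x) {e : E} (he : ‖e‖ = 1) {μ : ℝ} (hμ : 0 < μ)
    (hle : ∀ x ∈ closedBall (0 : E) R, ⟪x, e⟫ ≤ μ ∨ u x ≤ u (planeReflection e μ x))
    {x : E} (hx : ‖x‖ ≤ R) (hxμ : ⟪x, e⟫ = μ) : fderiv ℝ u x e < 0 := by
  have hμx : μ ≤ ‖x‖ := by
    have := real_inner_le_norm x e
    rw [he, mul_one] at this
    linarith
  rcases hx.lt_or_eq with hlt | heqR
  · have hμR : μ < R := hμx.trans_lt hlt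
    set w : E → ℝ := (fun x => u (planeReflection e μ x)) - (1 : ℝ) • u with hw
    have hwx : ∀ x, w x = u (planeReflection e μ x) - u x := fun x => by simp [hw]
    have hr := contDiff_comp_planeReflection hu e μ
    have hwC : ContDiff ℝ 2 w := hr.sub (hu.const_smul (1 : ℝ))
    set ρ : ℝ := (R - ‖x‖) / 2 with hρ
    have hρ0 : 0 < ρ := by rw [hρ]; linarith
    have hmem : ∀ a ∈ ball (x + ρ • e) ρ, ‖a‖ < R ∧ μ < ⟪a, e⟫ := by
      intro a ha
      rw [mem_ball, dist_eq_norm] at ha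
      have e1 : a = (a - (x + ρ • e)) + x + ρ • e := by abel
      have hne : ‖ρ • e‖ = ρ := by rw [norm_smul, he, mul_one, Real.norm_of_nonneg hρ0.le]
      constructor
      · have := norm_add₃_le (a := a - (x + ρ • e)) (b := x) (c := ρ • e)
        rw [← e1, hne] at this
        linarith
      · have h1 := abs_real_inner_le_norm (a - (x + ρ • e)) e
        rw [he, mul_one, abs_le] at h1
        rw [e1, inner_add_left, inner_add_left, real_inner_smul_left,
          real_inner_self_eq_norm_sq, he, hxμ]
        linarith [h1.1]
    have hlt' : ∀ a ∈ ball (x + ρ • e) ρ, u a < u (planeReflection e μ a) := fun a ha =>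
      lt_comp_planeReflection_of_le hu hg heq hbd hpos he hμ hμR hle (hmem a ha).1 (hmem a ha).2
    have hrefl : ∀ t : ℝ, planeReflection e μ (x + t • e) = x + t • (-e) := by
      intro t
      rw [planeReflection, inner_add_left, real_inner_smul_left,
          real_inner_self_eq_norm_sq, he, hxμ]
      module
    have hopf := hopf_boundary_lemma hwC (y := x + ρ • e) (x₀ := x) (d := e) hρ0 ?_ ?_ ?_ ?_ ?_
    · have h1 := hasDerivAt_comp_line hwC x e 0
      have h2 := (hasDerivAt_comp_line hu x (-e) 0).sub (hasDerivAt_comp_line hu x e 0)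
      have h3 : (fun s : ℝ => w (x + s • e)) =
          (fun s : ℝ => u (x + s • (-e))) - fun s : ℝ => u (x + s • e) := by
        funext s
        rw [hwx, hrefl]; rfl
      rw [h3] at h1
      have h4 := h1.unique h2
      simp only [zero_smul, add_zero, map_neg] at h4
      linarith
    · intro a ha
      rw [hw, laplacian_sub_smul hr hu, laplacian_comp_planeReflection hu he]
      have h1 := heq a (by simpa using (hmem a ha).1)
      have h2 := heq (planeReflection e μ a) (by
        simpa using norm_planeReflection_lt he hμ (hmem a ha).1.le (hmem a ha).2)
      have h3 := hg (hlt' a ha).le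
      linarith
    · intro a ha
      rw [hwx]; linarith [hlt' a ha]
    · rw [sub_add_cancel_left, norm_neg, norm_smul, he, mul_one, Real.norm_of_nonneg hρ0.le]
    · have := hrefl 0
      rw [zero_smul, zero_smul, add_zero] at this
      rw [hwx, this, sub_self]
    · rw [add_sub_cancel_left, inner_smul_right, real_inner_self_eq_norm_sq, he]
      linarith
  · have hR : 0 < R := by linarith
    have hopf := hopf_boundary_lemma hu (y := 0) (x₀ := x) (d := -e) hR
      (fun a ha => by linarith [heq a ha, hg0 (u a)]) hpos (by simpa using heqR) (hbd x heqR)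
      (by rw [zero_sub, inner_neg_neg, real_inner_comm, hxμ]; exact hμ)
    rw [map_neg] at hopf
    linarith

/-- The moving plane comparison on a ball. -/
theorem le_comp_planeReflection {u : E → ℝ} (hu : ContDiff ℝ 2 u) {R : ℝ} (hR : 0 < R)
    {g : ℝ → ℝ} (hg : Monotone g) (hg0 : ∀ t, 0 ≤ g t)
    (heq : ∀ x ∈ ball (0 : E) R, -Δ u x = g (u x)) (hbd : ∀ x : E, ‖x‖ = R → u x = 0)
    (hpos : ∀ x ∈ ball (0 : E) R, 0 < u x) {e : E} (he : ‖e‖ = 1) :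
    ∀ x ∈ closedBall (0 : E) R, ⟪x, e⟫ ≤ 0 ∨ u x ≤ u (planeReflection e 0 x) := by
  set A : Set ℝ := {μ | ∀ x ∈ closedBall (0 : E) R,
    ⟪x, e⟫ ≤ μ ∨ u x ≤ u (planeReflection e μ x)} with hA
  have hAclosed : IsClosed A := by
    have : A = ⋂ x ∈ closedBall (0 : E) R,
        ({μ | ⟪x, e⟫ ≤ μ} ∪ {μ | u x ≤ u (planeReflection e μ x)}) := by
      ext μ; simp [hA]
    rw [this]
    refine isClosed_biInter fun x _ => (isClosed_le continuous_const continuous_id).union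
      (isClosed_le continuous_const (hu.continuous.comp ?_))
    exact (continuous_planeReflection e).comp (by fun_prop : Continuous fun μ : ℝ => (μ, x))
  have hRA : R ∈ A := fun x hx => by
    left
    have h1 := real_inner_le_norm x e
    rw [he, mul_one] at h1
    exact h1.trans (by simpa using hx)
  suffices h : Icc 0 R ⊆ A from h ⟨le_rfl, hR.le⟩
  refine (hAclosed.inter isClosed_Icc).Icc_subset_of_forall_exists_lt hRA ?_
  rintro μ ⟨hμA, hμ0, hμR⟩ y hy
  have hy : y < μ := hy
  by_contra hempty
  rw [not_nonempty_iff_eq_empty] at hempty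
  set ν : ℕ → ℝ := fun n => μ - (μ - y) * (1 / ((n : ℝ) + 1)) with hν
  have hνlim : Tendsto ν atTop (𝓝 μ) := by
    have := (tendsto_one_div_add_atTop_nhds_zero_nat (𝕜 := ℝ)).const_mul (μ - y)
    simpa [hν] using this.const_sub μ
  have hνmem : ∀ n, ν n ∈ Ico y μ := by
    intro n
    have h1 : (0 : ℝ) < 1 / ((n : ℝ) + 1) := by positivity
    have h2 : 1 / ((n : ℝ) + 1) ≤ 1 := by
      rw [div_le_one (by positivity)]; linarith [(Nat.cast_nonneg n : (0 : ℝ) ≤ n)]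
    constructor <;> simp only [hν] <;> nlinarith
  have hνA : ∀ n, ∃ x ∈ closedBall (0 : E) R,
      ν n < ⟪x, e⟫ ∧ u (planeReflection e (ν n) x) < u x := by
    intro n
    have h1 : ν n ∉ A := fun h => by
      have : ν n ∈ A ∩ Ico y μ := ⟨h, hνmem n⟩
      rw [hempty] at this
      exact this
    simp only [hA, Set.mem_ofPred_eq] at h1
    push Not at h1
    exact h1
  choose x hxb hxν hxlt using hνA
  obtain ⟨a, hab, φ, hφ, hlim⟩ := (isCompact_closedBall (0 : E) R).tendsto_subseq hxb
  have hνφ := hνlim.comp hφ.tendsto_atTop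
  have hlimi : Tendsto (fun n => ⟪x (φ n), e⟫) atTop (𝓝 ⟪a, e⟫) :=
    ((by fun_prop : Continuous fun x : E => ⟪x, e⟫).tendsto a).comp hlim
  have hale : μ ≤ ⟪a, e⟫ := le_of_tendsto_of_tendsto' hνφ hlimi fun n => (hxν (φ n)).le
  have haR : ‖a‖ ≤ R := by simpa using hab
  rcases hale.lt_or_eq with hgt | heqμ
  · have hua : u (planeReflection e μ a) ≤ u a := by
      have h1 := ((hu.continuous.comp (continuous_planeReflection e)).tendsto (μ, a)).comp
        (hνφ.prodMk_nhds hlim)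
      exact le_of_tendsto_of_tendsto' h1 ((hu.continuous.tendsto a).comp hlim)
        fun n => (hxlt (φ n)).le
    have hμR' : μ < R := by
      have h1 := real_inner_le_norm a e
      rw [he, mul_one] at h1
      linarith
    rcases haR.lt_or_eq with hlt | haR
    · exact absurd (lt_comp_planeReflection_of_le hu hg heq hbd hpos he hμ0 hμR' hμA hlt hgt)
        (not_lt.2 hua)
    · rw [hbd a haR] at hua
      have := hpos (planeReflection e μ a) (by
        simpa using norm_planeReflection_lt he hμ0 haR.le hgt)
      linarith
  · have hneg := fderiv_neg_of_le_planeReflection hu hg hg0 heq hbd hpos he hμ0 hμA haR heqμ.symm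
    choose s hs hspos using fun n =>
      exists_fderiv_pos_of_planeReflection_lt hu (hxν n) (hxlt n)
    have hs0 : Tendsto (fun n => s (φ n)) atTop (𝓝 0) := by
      refine tendsto_of_tendsto_of_tendsto_of_le_of_le (g := fun n =>
        -(2 * (⟪x (φ n), e⟫ - ν (φ n)))) ?_ tendsto_const_nhds (fun n => (hs (φ n)).1.le)
        fun n => (hs (φ n)).2.le
      have := ((hlimi.sub hνφ).const_mul 2).neg
      simpa [← heqμ] using this
    have hlim2 : Tendsto (fun n => x (φ n) + s (φ n) • e) atTop (𝓝 a) := by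
      simpa using hlim.add (hs0.smul_const e)
    have hcont : Continuous fun x => fderiv ℝ u x e :=
      (hu.continuous_fderiv (by norm_num)).clm_apply continuous_const
    have := ge_of_tendsto' ((hcont.tendsto a).comp hlim2) fun n => (hspos (φ n)).le
    linarith

/-- Radial symmetry of positive solutions on a ball, for a nonnegative nondecreasing
nonlinearity. -/
theorem eq_of_norm_eq {u : E → ℝ} (hu : ContDiff ℝ 2 u) {R : ℝ} (hR : 0 < R)
    {g : ℝ → ℝ} (hg : Monotone g) (hg0 : ∀ t, 0 ≤ g t)
    (heq : ∀ x ∈ ball (0 : E) R, -Δ u x = g (u x)) (hbd : ∀ x : E, ‖x‖ = R → u x = 0)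
    (hpos : ∀ x ∈ ball (0 : E) R, 0 < u x) {x y : E} (hx : ‖x‖ ≤ R) (hxy : ‖x‖ = ‖y‖) :
    u x = u y := by
  have key : ∀ x y : E, ‖x‖ ≤ R → ‖x‖ = ‖y‖ → u x ≤ u y := by
    intro x y hx hxy
    rcases eq_or_ne x y with rfl | hne
    · exact le_rfl
    have hn : 0 < ‖x - y‖ := norm_pos_iff.2 (sub_ne_zero.2 hne)
    set e : E := ‖x - y‖⁻¹ • (x - y) with he
    have he1 : ‖e‖ = 1 := by
      rw [he, norm_smul, norm_inv, norm_norm, inv_mul_cancel₀ hn.ne']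
    have h1 : 2 * ⟪x, x - y⟫ = ‖x - y‖ ^ 2 := by
      rw [norm_sub_sq_real, inner_sub_right, real_inner_self_eq_norm_sq, ← hxy]; ring
    have h2 : 2 * ⟪x, e⟫ = ‖x - y‖ := by
      rw [he, inner_smul_right]
      field_simp
      linarith
    have h3 : planeReflection e 0 x = y := by
      rw [planeReflection, sub_zero, h2, he, smul_smul, mul_inv_cancel₀ hn.ne', one_smul]
      abel
    rcases le_comp_planeReflection hu hR hg hg0 heq hbd hpos he1 x (by simpa using hx) with h | h
    · linarith
    · rwa [h3] at h
  exact le_antisymm (key x y hx hxy) (key y x (hxy ▸ hx) hxy.symm)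

end MovingPlanes

section RadialODE

/-- `U` solves the radial equation `U'' + (d / t) U' + k (max U 0) ^ p = 0` on `(0, T)` with
derivative `V` satisfying `V 0 = 0`. -/
structure IsRadialSol (d : ℕ) (p k T : ℝ) (U V : ℝ → ℝ) : Prop where
  hasDerivAt : ∀ t, HasDerivAt U (V t) t
  continuous_deriv : Continuous V
  deriv_zero : V 0 = 0
  hasDerivAt_deriv : ∀ t ∈ Ioo 0 T, HasDerivAt V (-(d / t) * V t - k * (max (U t) 0) ^ p) t

namespace IsRadialSol

variable {d : ℕ} {p k T : ℝ} {U V : ℝ → ℝ}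

theorem continuous (h : IsRadialSol d p k T U V) : Continuous U :=
  continuous_iff_continuousAt.2 fun t => (h.hasDerivAt t).continuousAt

theorem mono (h : IsRadialSol d p k T U V) {T' : ℝ} (hT : T' ≤ T) : IsRadialSol d p k T' U V :=
  ⟨h.hasDerivAt, h.continuous_deriv, h.deriv_zero,
    fun t ht => h.hasDerivAt_deriv t ⟨ht.1, ht.2.trans_le hT⟩⟩

theorem rescale (h : IsRadialSol d p k T U V) {m s k' : ℝ} (hm : 0 < m) (hs : 0 < s)
    (hk : k * m ^ (p - 1) = s ^ 2 * k') :
    IsRadialSol d p k' (s * T) (fun t => U (t / s) / m) (fun t => V (t / s) / (m * s)) := by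
  have hlin : ∀ t, HasDerivAt (fun t : ℝ => t / s) (1 / s) t := fun t => (hasDerivAt_id t).div_const s
  refine ⟨fun t => ?_, ?_, ?_, fun t ht => ?_⟩
  · refine (((h.hasDerivAt (t / s)).comp t (hlin t)).div_const m).congr_deriv ?_
    field_simp
  · exact (h.continuous_deriv.comp (by fun_prop)).div_const _
  · simp [h.deriv_zero]
  · have ht0 : 0 < t := ht.1
    have hmem : t / s ∈ Ioo 0 T := ⟨by positivity, by rw [div_lt_iff₀ hs, mul_comm]; exact ht.2⟩
    refine (((h.hasDerivAt_deriv _ hmem).comp t (hlin t)).div_const (m * s)).congr_deriv ?_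
    have h1 : max (U (t / s) / m) 0 = max (U (t / s)) 0 / m := by
      rw [← max_div_div_right hm.le, zero_div]
    rw [h1, Real.div_rpow (le_max_right _ _) hm.le]
    set P := (max (U (t / s)) 0) ^ p
    have h2 : m ^ p = m ^ (p - 1) * m := by
      rw [Real.rpow_sub hm, Real.rpow_one]; field_simp
    have h3 : 0 < m ^ (p - 1) := Real.rpow_pos_of_pos hm _
    have h4 : k = s ^ 2 * k' / m ^ (p - 1) := by rw [← hk]; field_simp
    rw [h2, h4]
    field_simp

theorem hasDerivAt_flux (h : IsRadialSol d p k T U V) (hd : 1 ≤ d) {t : ℝ} (ht : t ∈ Ioo 0 T) :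
    HasDerivAt (fun t => t ^ d * V t) (-(k * (t ^ d * (max (U t) 0) ^ p))) t := by
  have ht0 : t ≠ 0 := ht.1.ne'
  refine ((hasDerivAt_pow d t).mul (h.hasDerivAt_deriv t ht)).congr_deriv ?_
  obtain ⟨e, rfl⟩ := Nat.exists_eq_add_of_le' hd
  rw [Nat.add_sub_cancel, pow_succ]
  field_simp
  ring

theorem continuous_flux (h : IsRadialSol d p k T U V) : Continuous fun t => t ^ d * V t :=
  (continuous_pow d).mul h.continuous_deriv

theorem antitoneOn_flux (h : IsRadialSol d p k T U V) (hd : 1 ≤ d) (hk : 0 ≤ k) :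
    AntitoneOn (fun t => t ^ d * V t) (Icc 0 T) := by
  refine antitoneOn_of_deriv_nonpos (convex_Icc _ _) h.continuous_flux.continuousOn ?_ ?_
  · rw [interior_Icc]
    exact fun t ht => (h.hasDerivAt_flux hd ht).differentiableAt.differentiableWithinAt
  · rw [interior_Icc]
    intro t ht
    rw [(h.hasDerivAt_flux hd ht).deriv, neg_nonpos]
    have := ht.1
    positivity

theorem deriv_nonpos (h : IsRadialSol d p k T U V) (hd : 1 ≤ d) (hk : 0 ≤ k) {t : ℝ}
    (ht : t ∈ Icc 0 T) : V t ≤ 0 := by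
  rcases ht.1.eq_or_lt with rfl | h0
  · exact h.deriv_zero.le
  have h1 := h.antitoneOn_flux hd hk ⟨le_rfl, ht.1.trans ht.2⟩ ht ht.1
  simp only [h.deriv_zero, mul_zero] at h1
  have : 0 < t ^ d := by positivity
  exact nonpos_of_mul_nonpos_right h1 this

theorem antitoneOn (h : IsRadialSol d p k T U V) (hd : 1 ≤ d) (hk : 0 ≤ k) :
    AntitoneOn U (Icc 0 T) := by
  refine antitoneOn_of_deriv_nonpos (convex_Icc _ _) h.continuous.continuousOn
    (fun t _ => (h.hasDerivAt t).differentiableAt.differentiableWithinAt) fun t ht => ?_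
  rw [(h.hasDerivAt t).deriv]
  exact h.deriv_nonpos hd hk (interior_subset ht)

theorem deriv_neg (h : IsRadialSol d p k T U V) (hd : 1 ≤ d) (hk : 0 < k) (hU : 0 < U 0) {t : ℝ}
    (ht : t ∈ Ioc 0 T) : V t < 0 := by
  refine lt_of_le_of_ne (h.deriv_nonpos hd hk.le ⟨ht.1.le, ht.2⟩) fun hV => ?_
  have hflux : ∀ s ∈ Icc 0 t, s ^ d * V s = 0 := by
    intro s hs
    have hsT : s ∈ Icc 0 T := ⟨hs.1, hs.2.trans ht.2⟩
    have h1 := h.antitoneOn_flux hd hk.le hsT ⟨ht.1.le, ht.2⟩ hs.2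
    simp only [hV, mul_zero] at h1
    have := h.deriv_nonpos hd hk.le hsT
    exact le_antisymm (mul_nonpos_of_nonneg_of_nonpos (pow_nonneg hs.1 d) this) h1
  have hUnp : ∀ s ∈ Ioo 0 t, U s ≤ 0 := by
    intro s hs
    have h1 := (h.hasDerivAt_flux hd ⟨hs.1, hs.2.trans_le ht.2⟩).deriv
    have h2 : (fun t => t ^ d * V t) =ᶠ[nhds s] fun _ => 0 := by
      filter_upwards [isOpen_Ioo.mem_nhds hs] with r hr using hflux r ⟨hr.1.le, hr.2.le⟩
    rw [h2.deriv_eq, deriv_const] at h1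
    by_contra! hpos
    have h3 : 0 < (max (U s) 0) ^ p := Real.rpow_pos_of_pos (lt_max_of_lt_left hpos) _
    have h4 : 0 < s ^ d := pow_pos hs.1 _
    have : 0 < k * (s ^ d * (max (U s) 0) ^ p) := by positivity
    linarith
  have hev : ∀ᶠ s in nhdsWithin (0 : ℝ) (Ioi 0), 0 < U s :=
    nhdsWithin_le_nhds (continuousAt_const.eventually_lt h.continuous.continuousAt hU)
  obtain ⟨s, hs1, hs2⟩ := (hev.and (Ioo_mem_nhdsGT ht.1)).exists
  exact absurd hs1 (not_lt.2 (hUnp s hs2))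

theorem strictAntiOn (h : IsRadialSol d p k T U V) (hd : 1 ≤ d) (hk : 0 < k) (hU : 0 < U 0) :
    StrictAntiOn U (Icc 0 T) := by
  refine strictAntiOn_of_deriv_neg (convex_Icc _ _) h.continuous.continuousOn fun t ht => ?_
  rw [interior_Icc] at ht
  rw [(h.hasDerivAt t).deriv]
  exact h.deriv_neg hd hk hU ⟨ht.1, ht.2.le⟩

end IsRadialSol

theorem abs_max_rpow_sub_le {p : ℝ} (hp : 1 < p) {x y : ℝ} (hx : x ≤ 1) (hy : y ≤ 1) :
    |(max x 0) ^ p - (max y 0) ^ p| ≤ p * |x - y| := by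
  have hx' : max x 0 ∈ Icc (0 : ℝ) 1 := ⟨le_max_right _ _, max_le hx zero_le_one⟩
  have hy' : max y 0 ∈ Icc (0 : ℝ) 1 := ⟨le_max_right _ _, max_le hy zero_le_one⟩
  have h1 := (convex_Icc (0 : ℝ) 1).norm_image_sub_le_of_norm_hasDerivWithin_le
    (f := fun x : ℝ => x ^ p) (f' := fun x : ℝ => p * x ^ (p - 1)) (C := p)
    (fun z _ => (Real.hasDerivAt_rpow_const (Or.inr hp.le)).hasDerivWithinAt)
    (fun z hz => by
      rw [Real.norm_of_nonneg (mul_nonneg (by linarith) (Real.rpow_nonneg hz.1 _))]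
      have := Real.rpow_le_one hz.1 hz.2 (by linarith : 0 ≤ p - 1)
      nlinarith) hy' hx'
  rw [Real.norm_eq_abs, Real.norm_eq_abs] at h1
  exact h1.trans (mul_le_mul_of_nonneg_left (abs_max_sub_max_le_abs x y 0) (by linarith))

theorem IsRadialSol.eq_of_zero_eq_one {d : ℕ} {p T : ℝ} {U₁ V₁ U₂ V₂ : ℝ → ℝ} (hd : 1 ≤ d)
    (hp : 1 < p) (h₁ : IsRadialSol d p 1 T U₁ V₁) (h₂ : IsRadialSol d p 1 T U₂ V₂)
    (h₁0 : U₁ 0 = 1) (h₂0 : U₂ 0 = 1) {t : ℝ} (ht : t ∈ Icc 0 T) :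
    U₁ t = U₂ t ∧ V₁ t = V₂ t := by
  have hle : ∀ {U V : ℝ → ℝ}, IsRadialSol d p 1 T U V → U 0 = 1 → ∀ s ∈ Icc 0 T, U s ≤ 1 :=
    fun h h0 s hs => h0 ▸ h.antitoneOn hd zero_le_one ⟨le_rfl, hs.1.trans hs.2⟩ hs hs.1
  set G : ℝ → ℝ := fun s =>
    ((U₁ s - U₂ s) ^ 2 + (V₁ s - V₂ s) ^ 2) * Real.exp (-(1 + p) * s) with hG
  have hGc : Continuous G := by
    have := h₁.continuous; have := h₂.continuous
    have := h₁.continuous_deriv; have := h₂.continuous_deriv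
    fun_prop
  have hGd : ∀ s ∈ Ioo 0 T, HasDerivAt G ((2 * (U₁ s - U₂ s) * (V₁ s - V₂ s) +
      2 * (V₁ s - V₂ s) * (-(d / s) * (V₁ s - V₂ s) - ((max (U₁ s) 0) ^ p - (max (U₂ s) 0) ^ p)) -
      (1 + p) * ((U₁ s - U₂ s) ^ 2 + (V₁ s - V₂ s) ^ 2)) * Real.exp (-(1 + p) * s)) s := by
    intro s hs
    have hu := ((h₁.hasDerivAt s).sub (h₂.hasDerivAt s)).pow 2
    have hv := ((h₁.hasDerivAt_deriv s hs).sub (h₂.hasDerivAt_deriv s hs)).pow 2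
    have he := ((hasDerivAt_id s).const_mul (-(1 + p))).exp
    refine ((hu.add hv).mul he).congr_deriv ?_
    simp only [id, Pi.add_apply, Pi.pow_apply, Pi.sub_apply]
    push_cast
    ring
  have hanti : AntitoneOn G (Icc 0 T) := by
    refine antitoneOn_of_deriv_nonpos (convex_Icc _ _) hGc.continuousOn ?_ ?_ <;> rw [interior_Icc]
    · exact fun s hs => (hGd s hs).differentiableAt.differentiableWithinAt
    · intro s hs
      rw [(hGd s hs).deriv]
      refine mul_nonpos_of_nonpos_of_nonneg ?_ (Real.exp_pos _).le
      have hs' : s ∈ Icc 0 T := ⟨hs.1.le, hs.2.le⟩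
      have hL := abs_max_rpow_sub_le hp (hle h₁ h₁0 s hs') (hle h₂ h₂0 s hs')
      set x := U₁ s - U₂ s
      set y := V₁ s - V₂ s
      set q := (max (U₁ s) 0) ^ p - (max (U₂ s) 0) ^ p
      have h3 : -(y * q) ≤ p * (|x| * |y|) := by
        calc -(y * q) ≤ |y * q| := neg_le_abs _
          _ = |y| * |q| := abs_mul _ _
          _ ≤ |y| * (p * |x|) := by gcongr
          _ = _ := by ring
      have h4 : 2 * (|x| * |y|) ≤ x ^ 2 + y ^ 2 := by
        nlinarith [sq_nonneg (|x| - |y|), sq_abs x, sq_abs y]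
      have h5 : 2 * (x * y) ≤ x ^ 2 + y ^ 2 := by nlinarith [sq_nonneg (x - y)]
      have h6 : 0 ≤ (d / s : ℝ) * y ^ 2 := by
        have := hs.1
        positivity
      nlinarith
  have h0T : (0 : ℝ) ∈ Icc 0 T := ⟨le_rfl, ht.1.trans ht.2⟩
  have h1 : G t ≤ G 0 := hanti h0T ht ht.1
  have h2 : G 0 = 0 := by simp [hG, h₁0, h₂0, h₁.deriv_zero, h₂.deriv_zero]
  rw [h2] at h1
  have h3 : (U₁ t - U₂ t) ^ 2 + (V₁ t - V₂ t) ^ 2 ≤ 0 :=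
    nonpos_of_mul_nonpos_left h1 (Real.exp_pos _)
  constructor <;> nlinarith [sq_nonneg (U₁ t - U₂ t), sq_nonneg (V₁ t - V₂ t)]

namespace IsRadialSol

variable {d : ℕ} {p T : ℝ} {U V : ℝ → ℝ}

/-- The quantity proportional to a power of `λ` along the normalized profile increases strictly. -/
theorem rpow_mul_deriv_rpow_lt (h : IsRadialSol d p 1 T U V) (hd : 1 ≤ d) (hp : 1 < p)
    (hpd : p * ((d : ℝ) - 1) < d + 1) (hU : 0 < U 0) {t₁ t₂ : ℝ} (ht₁ : 0 < t₁) (ht : t₁ < t₂)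
    (ht₂ : t₂ ≤ T) :
    t₁ ^ (p + 1) * (-V t₁) ^ (p - 1) < t₂ ^ (p + 1) * (-V t₂) ^ (p - 1) := by
  have ht₂0 : 0 < t₂ := ht₁.trans ht
  have key : ∀ t ∈ Ioc 0 T, t ^ (p + 1) * (-V t) ^ (p - 1) =
      t ^ (p + 1 - d * (p - 1)) * (t ^ d * -V t) ^ (p - 1) := by
    intro t ht
    have h1 := h.deriv_neg hd one_pos hU ht
    rw [Real.mul_rpow (pow_nonneg ht.1.le _) (by linarith), ← mul_assoc, ← Real.rpow_natCast,
      ← Real.rpow_mul ht.1.le, ← Real.rpow_add ht.1]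
    congr 2
    ring
  rw [key t₁ ⟨ht₁, ht.le.trans ht₂⟩, key t₂ ⟨ht₂0, ht₂⟩]
  have hflux := h.antitoneOn_flux hd zero_le_one ⟨ht₁.le, ht.le.trans ht₂⟩ ⟨ht₂0.le, ht₂⟩ ht.le
  have hV₁ := h.deriv_neg hd one_pos hU ⟨ht₁, ht.le.trans ht₂⟩
  have hw : 0 < t₁ ^ d * -V t₁ := mul_pos (pow_pos ht₁ _) (by linarith)
  have hle : t₁ ^ d * -V t₁ ≤ t₂ ^ d * -V t₂ := by
    simp only [mul_neg]; exact neg_le_neg hflux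
  refine mul_lt_mul (Real.rpow_lt_rpow ht₁.le ht (by linarith))
    (Real.rpow_le_rpow hw.le hle (by linarith)) (Real.rpow_pos_of_pos hw _)
    (Real.rpow_nonneg ht₂0.le _)

/-- Positivity of a Pohozaev-type quantity while the profile is positive. -/
theorem pohozaev_pos (h : IsRadialSol d p 1 T U V) (hd : 1 ≤ d) (hp : 1 < p)
    (hpd : p * ((d : ℝ) - 1) < d + 1) (hU : 0 < U T) {t : ℝ} (ht : t ∈ Ioc 0 T) :
    0 < t ^ (d + 1) * (p * V t ^ 2 + U t * U t ^ p) + (d + 1) * (t ^ d * (U t * V t)) := by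
  have hT : 0 < T := ht.1.trans_le ht.2
  have hUpos : ∀ s ∈ Icc 0 T, 0 < U s := fun s hs =>
    hU.trans_le (h.antitoneOn hd zero_le_one hs ⟨hT.le, le_rfl⟩ hs.2)
  set Φ : ℝ → ℝ := fun t =>
    t ^ (d + 1) * (p * V t ^ 2 + U t * U t ^ p) + (d + 1) * (t ^ d * (U t * V t)) with hΦ
  have hΦc : Continuous Φ := by
    have := h.continuous
    have := h.continuous_deriv
    have : Continuous fun t => U t ^ p := h.continuous.rpow_const fun _ => Or.inr (by linarith)
    fun_prop
  have hΦd : ∀ s ∈ Ioo 0 T, HasDerivAt Φ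
      (s ^ d * ((d + 1 - p * (d - 1)) * V s ^ 2 - (p - 1) * s * V s * U s ^ p)) s := by
    intro s hs
    have hUs := hUpos s ⟨hs.1.le, hs.2.le⟩
    have hs0 : s ≠ 0 := hs.1.ne'
    have hv := h.hasDerivAt_deriv s hs
    rw [max_eq_left hUs.le, one_mul] at hv
    have hu := h.hasDerivAt s
    have hup := hu.rpow_const (p := p) (Or.inl hUs.ne')
    have e1 : U s ^ (p - 1) = U s ^ p / U s := by rw [Real.rpow_sub hUs, Real.rpow_one]
    rw [e1] at hup
    refine (((hasDerivAt_pow (d + 1) s).mul (((hv.pow 2).const_mul p).add (hu.mul hup))).add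
      (((hasDerivAt_pow d s).mul (hu.mul hv)).const_mul ((d : ℝ) + 1))).congr_deriv ?_
    obtain ⟨e, rfl⟩ := Nat.exists_eq_add_of_le' hd
    simp only [Nat.add_sub_cancel, Pi.add_apply, Pi.pow_apply, Pi.mul_apply]
    push_cast
    rw [pow_succ s (e + 1), pow_succ s e]
    field_simp
    ring
  have hmono : StrictMonoOn Φ (Icc 0 T) := by
    refine strictMonoOn_of_deriv_pos (convex_Icc _ _) hΦc.continuousOn fun s hs => ?_
    rw [interior_Icc] at hs
    rw [(hΦd s hs).deriv]
    have hs0 := hs.1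
    have hUs := hUpos s ⟨hs.1.le, hs.2.le⟩
    have hV := h.deriv_neg hd one_pos (hUpos 0 ⟨le_rfl, hT.le⟩) ⟨hs.1, hs.2.le⟩
    have h1 : 0 < U s ^ p := Real.rpow_pos_of_pos hUs _
    have h2 : 0 < s * -V s * U s ^ p := by
      have : 0 < -V s := by linarith
      positivity
    have h3 : 0 < V s ^ 2 := by
      have := hV.ne
      positivity
    refine mul_pos (pow_pos hs0 _) ?_
    nlinarith [mul_pos (sub_pos.2 hpd) h3, mul_pos (sub_pos.2 hp) h2]
  have h0 : Φ 0 = 0 := by simp [hΦ, h.deriv_zero]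
  rw [← h0]
  exact hmono ⟨le_rfl, hT.le⟩ ⟨ht.1.le, ht.2⟩ ht.1

theorem strictAntiOn_rpow_mul_div (h : IsRadialSol d p 1 T U V) (hd : 1 ≤ d) (hp : 1 < p)
    (hpd : p * ((d : ℝ) - 1) < d + 1) (hU : 0 < U T) :
    StrictAntiOn (fun t => U t ^ p * (t / -V t)) (Ioc 0 T) := by
  intro t₁ ht₁ t₂ ht₂ ht
  have hT : 0 < T := ht₁.1.trans_le ht₁.2
  have hUpos : ∀ s ∈ Icc 0 T, 0 < U s := fun s hs =>
    hU.trans_le (h.antitoneOn hd zero_le_one hs ⟨hT.le, le_rfl⟩ hs.2)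
  have hVneg : ∀ s ∈ Ioc 0 T, V s < 0 := fun s hs =>
    h.deriv_neg hd one_pos (hUpos 0 ⟨le_rfl, hT.le⟩) hs
  have hsub : Icc t₁ t₂ ⊆ Ioc 0 T := fun s hs => ⟨ht₁.1.trans_le hs.1, hs.2.trans ht₂.2⟩
  refine strictAntiOn_of_deriv_neg (f := fun t => U t ^ p * (t / -V t)) (convex_Icc t₁ t₂) ?_ ?_
    ⟨le_rfl, ht.le⟩ ⟨ht.le, le_rfl⟩ ht
  · refine ((h.continuous.rpow_const fun _ => Or.inr (by linarith)).continuousOn).mul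
      (continuousOn_id.div h.continuous_deriv.neg.continuousOn fun s hs => ?_)
    have := hVneg s (hsub hs)
    exact (neg_pos.2 this).ne'
  · rw [interior_Icc]
    intro s hs
    have hs' : s ∈ Ioo 0 T := ⟨ht₁.1.trans hs.1, hs.2.trans_le ht₂.2⟩
    have hUs := hUpos s ⟨hs'.1.le, hs'.2.le⟩
    have hVs := hVneg s ⟨hs'.1, hs'.2.le⟩
    have hs0 : s ≠ 0 := hs'.1.ne'
    have hv := h.hasDerivAt_deriv s hs'
    rw [max_eq_left hUs.le, one_mul] at hv
    have hu := h.hasDerivAt s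
    have hup := hu.rpow_const (p := p) (Or.inl hUs.ne')
    have e1 : U s ^ (p - 1) = U s ^ p / U s := by rw [Real.rpow_sub hUs, Real.rpow_one]
    rw [e1] at hup
    have hder := hup.mul ((hasDerivAt_id s).div hv.neg (neg_pos.2 hVs).ne')
    have hP : 0 < U s ^ p := Real.rpow_pos_of_pos hUs _
    have hpoh := h.pohozaev_pos hd hp hpd hU ⟨hs'.1, hs'.2.le⟩
    have hval : deriv (fun t => U t ^ p * (t / -V t)) s =
        -(U s ^ p / (U s * s ^ d * V s ^ 2)) *
          (s ^ (d + 1) * (p * V s ^ 2 + U s * U s ^ p) + (d + 1) * (s ^ d * (U s * V s))) := by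
      refine (hder.congr_deriv ?_).deriv
      have := hVs.ne
      simp only [id, Pi.neg_apply, Pi.div_apply]
      have hsd : s ^ d ≠ 0 := pow_ne_zero _ hs0
      rw [pow_succ]
      field_simp
      ring
    rw [hval]
    have hsd : 0 < s ^ d := pow_pos hs'.1 _
    have h3 : 0 < V s ^ 2 := by
      have := hVs.ne
      positivity
    exact mul_neg_of_neg_of_pos (neg_neg_of_pos (by positivity)) hpoh

/-- The boundary value of the rescaled profile decreases strictly with the scale. -/
theorem mul_rpow_lt (h : IsRadialSol d p 1 T U V) (hd : 1 ≤ d) (hp : 1 < p)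
    (hpd : p * ((d : ℝ) - 1) < d + 1) (hU : 0 < U 0) {t₁ : ℝ} (ht₁ : 0 < t₁) (ht : t₁ < T) :
    U T * (T / -V T) ^ (1 / p) < U t₁ * (t₁ / -V t₁) ^ (1 / p) := by
  have hT : 0 < T := ht₁.trans ht
  have hV₁ := h.deriv_neg hd one_pos hU ⟨ht₁, ht.le⟩
  have hV₂ := h.deriv_neg hd one_pos hU ⟨hT, le_rfl⟩
  have hm₁ : 0 < t₁ / -V t₁ := div_pos ht₁ (by linarith)
  have hm₂ : 0 < T / -V T := div_pos hT (by linarith)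
  have hM₁ := Real.rpow_pos_of_pos hm₁ (1 / p)
  have hM₂ := Real.rpow_pos_of_pos hm₂ (1 / p)
  have hp0 : 0 < p := by linarith
  rcases le_or_gt (U t₁) 0 with hU₁ | hU₁
  · have hlt : U T < U t₁ := h.strictAntiOn hd one_pos hU ⟨ht₁.le, ht.le⟩ ⟨hT.le, le_rfl⟩ ht
    have hflux : MonotoneOn (fun t => t ^ d * V t) (Icc t₁ T) := by
      refine monotoneOn_of_deriv_nonneg (convex_Icc _ _) h.continuous_flux.continuousOn ?_ ?_ <;>
        rw [interior_Icc]
      · exact fun s hs =>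
          (h.hasDerivAt_flux hd ⟨ht₁.trans hs.1, hs.2⟩).differentiableAt.differentiableWithinAt
      · intro s hs
        rw [(h.hasDerivAt_flux hd ⟨ht₁.trans hs.1, hs.2⟩).deriv]
        have : U s ≤ 0 := (h.antitoneOn hd zero_le_one ⟨ht₁.le, ht.le⟩
          ⟨(ht₁.trans hs.1).le, hs.2.le⟩ hs.1.le).trans hU₁
        rw [max_eq_right this, Real.zero_rpow hp0.ne']
        simp
    have hfl : t₁ ^ d * V t₁ ≤ T ^ d * V T := hflux ⟨le_rfl, ht.le⟩ ⟨ht.le, le_rfl⟩ ht.le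
    have hmle : t₁ / -V t₁ ≤ T / -V T := by
      rw [div_le_div_iff₀ (by linarith) (by linarith)]
      have h1 : t₁ ^ d ≤ T ^ d := pow_le_pow_left₀ ht₁.le ht.le d
      have h2 : 0 < t₁ ^ d := pow_pos ht₁ _
      have h3 : -V T ≤ -V t₁ := by nlinarith
      exact mul_le_mul ht.le h3 (by linarith) hT.le
    have hMle : (t₁ / -V t₁) ^ (1 / p) ≤ (T / -V T) ^ (1 / p) :=
      Real.rpow_le_rpow hm₁.le hmle (by positivity)
    nlinarith
  · rcases le_or_gt (U T) 0 with hUT | hUT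
    · exact (mul_nonpos_of_nonpos_of_nonneg hUT hM₂.le).trans_lt (mul_pos hU₁ hM₁)
    · have key := h.strictAntiOn_rpow_mul_div hd hp hpd hUT ⟨ht₁, ht.le⟩ ⟨hT, le_rfl⟩ ht
      rw [← Real.rpow_lt_rpow_iff (by positivity) (by positivity) hp0, Real.mul_rpow hUT.le hM₂.le,
        Real.mul_rpow hU₁.le hM₁.le, ← Real.rpow_mul hm₂.le, ← Real.rpow_mul hm₁.le,
        one_div_mul_cancel hp0.ne', Real.rpow_one, Real.rpow_one]
      exact key

end IsRadialSol

end RadialODE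

section Radial

open scoped Laplacian RealInnerProductSpace Topology
open Filter Module

variable {E : Type*} [NormedAddCommGroup E] [InnerProductSpace ℝ E]

theorem fderiv_fderiv_tangential {f : E → ℝ} (hf : ContDiff ℝ 2 f) {e v : E} (he : ‖e‖ = 1)
    (hv : ‖v‖ = 1) (hev : ⟪e, v⟫ = 0) {r : ℝ} (hr : 0 < r)
    (hrad : ∀ x, ‖x‖ = r → f x = f (r • e)) :
    fderiv ℝ (fderiv ℝ f) (r • e) v v = fderiv ℝ f (r • e) e / r := by
  set γ : ℝ → E := fun θ => (r * Real.cos θ) • e + (r * Real.sin θ) • v with hγ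
  set δ : ℝ → E := fun θ => (r * -Real.sin θ) • e + (r * Real.cos θ) • v with hδ
  have hγd : ∀ θ, HasDerivAt γ (δ θ) θ := fun θ =>
    (((Real.hasDerivAt_cos θ).const_mul r).smul_const e).add
      (((Real.hasDerivAt_sin θ).const_mul r).smul_const v)
  have hδd : ∀ θ, HasDerivAt δ ((r * -Real.cos θ) • e + (r * -Real.sin θ) • v) θ := fun θ =>
    (((Real.hasDerivAt_sin θ).neg.const_mul r).smul_const e).add
      (((Real.hasDerivAt_cos θ).const_mul r).smul_const v)
  have hnorm : ∀ θ, ‖γ θ‖ = r := by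
    intro θ
    have h1 : ‖γ θ‖ ^ 2 = r ^ 2 := by
      rw [hγ, norm_add_sq_real, norm_smul, norm_smul, inner_smul_left, inner_smul_right, hev, he, hv]
      simp only [mul_one, mul_zero, add_zero, Real.norm_eq_abs, sq_abs]
      linear_combination r ^ 2 * Real.sin_sq_add_cos_sq θ
    exact (sq_eq_sq₀ (norm_nonneg _) hr.le).1 h1
  have hzero : (fun θ => fderiv ℝ f (γ θ) (δ θ)) = fun _ => 0 := by
    funext θ
    have h1 := ((hf.differentiable (by norm_num)) (γ θ)).hasFDerivAt.comp_hasDerivAt θ (hγd θ)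
    have h2 : f ∘ γ = fun _ => f (r • e) := funext fun θ => hrad _ (hnorm θ)
    rw [h2] at h1
    exact h1.unique (hasDerivAt_const θ _)
  have h1 := hasDerivAt_fderiv_comp hf (hγd 0) (hδd 0)
  rw [hzero] at h1
  have h2 := h1.unique (hasDerivAt_const 0 _)
  simp only [hγ, hδ, Real.cos_zero, Real.sin_zero, mul_one, mul_zero, neg_zero, zero_smul,
    add_zero, zero_add, map_smul, smul_eq_mul, mul_neg, neg_smul, map_neg,
    _root_.smul_apply] at h2
  have h3 : r * (r * fderiv ℝ (fderiv ℝ f) (r • e) v v) = r * fderiv ℝ f (r • e) e := by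
    linarith
  rw [eq_div_iff hr.ne']
  have := mul_left_cancel₀ hr.ne' h3
  linarith

theorem laplacian_radial [FiniteDimensional ℝ E] {ι : Type*} [Fintype ι]
    (b : OrthonormalBasis ι ℝ E) (i₀ : ι) {f : E → ℝ} (hf : ContDiff ℝ 2 f) {r : ℝ} (hr : 0 < r)
    (hrad : ∀ x, ‖x‖ = r → f x = f (r • b i₀)) :
    Δ f (r • b i₀) = fderiv ℝ (fderiv ℝ f) (r • b i₀) (b i₀) (b i₀) +
      ((Fintype.card ι - 1 : ℕ) : ℝ) * (fderiv ℝ f (r • b i₀) (b i₀) / r) := by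
  classical
  rw [laplacian_eq_sum_fderiv b, ← Finset.add_sum_erase _ _ (Finset.mem_univ i₀)]
  congr 1
  rw [Finset.sum_congr rfl fun i hi => fderiv_fderiv_tangential hf (b.orthonormal.1 i₀)
    (b.orthonormal.1 i) (b.orthonormal.2 (Finset.ne_of_mem_erase hi).symm) hr hrad]
  rw [Finset.sum_const, Finset.card_erase_of_mem (Finset.mem_univ _), Finset.card_univ,
    nsmul_eq_mul]

theorem fderiv_zero_of_even {f : E → ℝ} (hf : ContDiff ℝ 2 f)
    (heven : ∀ᶠ x in 𝓝 (0 : E), f (-x) = f x) : fderiv ℝ f 0 = 0 := by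
  have h1 : HasFDerivAt f (fderiv ℝ f 0) (-0 : E) := by
    rw [neg_zero]; exact (hf.differentiable (by norm_num) 0).hasFDerivAt
  have h2 := h1.comp (0 : E) (hasFDerivAt_id (0 : E)).neg
  have h3 := (h2.congr_of_eventuallyEq (heven.mono fun x hx => hx.symm)).unique
    (hf.differentiable (by norm_num) 0).hasFDerivAt
  ext v
  have h4 := DFunLike.congr_fun h3 v
  simp at h4 ⊢
  linarith

theorem isRadialSol_of_radial [FiniteDimensional ℝ E] {ι : Type*} [Fintype ι]
    (b : OrthonormalBasis ι ℝ E) (i₀ : ι) {f : E → ℝ} (hf : ContDiff ℝ 2 f) {R p lam α : ℝ}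
    (hR : 0 < R) (hrad : ∀ x y, ‖x‖ ≤ R → ‖x‖ = ‖y‖ → f x = f y)
    (heq : ∀ x ∈ ball (0 : E) R, -Δ f x = (max (α + lam * f x) 0) ^ p) :
    IsRadialSol (Fintype.card ι - 1) p lam R (fun r => α + lam * f (r • b i₀))
      (fun r => lam * fderiv ℝ f (r • b i₀) (b i₀)) := by
  have he : ‖b i₀‖ = 1 := b.orthonormal.1 i₀
  refine ⟨fun t => ?_, ?_, ?_, fun t ht => ?_⟩
  · have := hasDerivAt_comp_line hf 0 (b i₀) t
    simp only [zero_add] at this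
    exact (this.const_mul lam).const_add α
  · have h1 : Continuous (fderiv ℝ f) := hf.continuous_fderiv (by norm_num)
    have h2 : Continuous fun r : ℝ => r • b i₀ := by fun_prop
    exact continuous_const.mul ((h1.comp h2).clm_apply continuous_const)
  · have h0 : fderiv ℝ f 0 = 0 := by
      refine fderiv_zero_of_even hf ?_
      filter_upwards [ball_mem_nhds (0 : E) hR] with x hx
      exact hrad _ _ (by simpa using (mem_ball_zero_iff.1 hx).le) (norm_neg x)
    simp [h0]
  · have hnt : ‖t • b i₀‖ = t := by rw [norm_smul, he, mul_one, Real.norm_of_nonneg ht.1.le]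
    have h1 := hasDerivAt_fderiv_line hf 0 (b i₀) (b i₀) t
    simp only [zero_add] at h1
    have h2 := laplacian_radial b i₀ hf ht.1 fun x hx => hrad _ _ (hx.le.trans ht.2.le)
      (hx.trans hnt.symm)
    have h3 := heq (t • b i₀) (by rw [mem_ball_zero_iff, hnt]; exact ht.2)
    rw [← h3, h2]
    refine (h1.const_mul lam).congr_deriv ?_
    ring

end Radial

section Mass

open scoped Topology
open Filter Module

theorem setIntegral_ball_radial {N : ℕ} [NeZero N] {R : ℝ}
    {F : EuclideanSpace ℝ (Fin N) → ℝ} {g : ℝ → ℝ}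
    (hF : ∀ x ∈ ball (0 : EuclideanSpace ℝ (Fin N)) R, F x = g ‖x‖) (hR : 0 ≤ R) :
    ∫ x in ball (0 : EuclideanSpace ℝ (Fin N)) R, F x =
      N * (volume.real (ball (0 : EuclideanSpace ℝ (Fin N)) 1) *
        ∫ t in (0 : ℝ)..R, t ^ (N - 1) * g t) := by
  have h1 : ∫ x in ball (0 : EuclideanSpace ℝ (Fin N)) R, F x =
      ∫ x : EuclideanSpace ℝ (Fin N), (Iio R).indicator g ‖x‖ := by
    rw [← integral_indicator measurableSet_ball]
    congr 1
    funext x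
    by_cases hx : x ∈ ball (0 : EuclideanSpace ℝ (Fin N)) R
    · rw [indicator_of_mem hx, indicator_of_mem (by simpa using hx), hF x hx]
    · rw [indicator_of_notMem hx, indicator_of_notMem (by simpa using hx)]
  have h2 : ∫ t in Ioi (0 : ℝ), t ^ (N - 1) • (Iio R).indicator g t =
      ∫ t in (0 : ℝ)..R, t ^ (N - 1) * g t := by
    rw [intervalIntegral.integral_of_le hR, integral_Ioc_eq_integral_Ioo,
      ← integral_indicator measurableSet_Ioi, ← integral_indicator measurableSet_Ioo]
    congr 1
    funext t
    by_cases h0 : 0 < t <;> by_cases ht : t < R <;> simp [indicator, h0, ht]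
  rw [h1, integral_fun_norm_addHaar volume, finrank_euclideanSpace, Fintype.card_fin, h2,
    nsmul_eq_mul, smul_eq_mul]

end Mass

section Solutions

open scoped Laplacian Topology
open Filter Module

theorem lapl_eq_laplacian {N : ℕ} {f : EuclideanSpace ℝ (Fin N) → ℝ} (hf : ContDiff ℝ 2 f)
    (x : EuclideanSpace ℝ (Fin N)) : lapl f x = Δ f x := by
  rw [laplacian_eq_sum_fderiv (EuclideanSpace.basisFun (Fin N) ℝ), lapl]
  refine Finset.sum_congr rfl fun i _ => ?_
  have h1 : DifferentiableAt ℝ (fderiv ℝ f) x :=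
    (hf.fderiv_right (m := 1) (by norm_num)).differentiable (by norm_num) x
  rw [EuclideanSpace.basisFun_apply, fderiv_clm_apply h1 (differentiableAt_const _)]
  simp

theorem volume_real_unit_ball_pos (N : ℕ) :
    0 < volume.real (ball (0 : EuclideanSpace ℝ (Fin N)) 1) :=
  ENNReal.toReal_pos (measure_ball_pos _ _ one_pos).ne' measure_ball_lt_top.ne

theorem RN_pos (N : ℕ) : 0 < RN N := Real.rpow_pos_of_pos (volume_real_unit_ball_pos N) _

theorem volume_real_unit_ball_mul_RN_pow (N : ℕ) [NeZero N] :
    volume.real (ball (0 : EuclideanSpace ℝ (Fin N)) 1) * RN N ^ N = 1 := by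
  have h0 := volume_real_unit_ball_pos N
  have hN : (N : ℝ) ≠ 0 := Nat.cast_ne_zero.2 (NeZero.ne N)
  have h1 : RN N ^ N = (volume.real (ball (0 : EuclideanSpace ℝ (Fin N)) 1)) ^ (-1 : ℝ) := by
    rw [RN, ← Real.rpow_natCast, ← Real.rpow_mul ENNReal.toReal_nonneg, div_mul_cancel₀ _ hN]
    rfl
  rw [h1, Real.rpow_neg_one, mul_inv_cancel₀ h0.ne']

theorem volume_real_DN (N : ℕ) [NeZero N] : volume.real (DN N) = 1 := by
  rw [DN, measureReal_def, Measure.addHaar_ball_of_pos _ _ (RN_pos N), ENNReal.toReal_mul,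
    ENNReal.toReal_ofReal (pow_nonneg (RN_pos N).le _), finrank_euclideanSpace, Fintype.card_fin,
    mul_comm]
  exact volume_real_unit_ball_mul_RN_pow N

theorem monotone_max_affine_rpow {p lam α : ℝ} (hp : 0 ≤ p) (hlam : 0 ≤ lam) :
    Monotone fun t : ℝ => (max (α + lam * t) 0) ^ p := fun s t hst =>
  Real.rpow_le_rpow (le_max_right _ _)
    (max_le_max (by linarith [mul_le_mul_of_nonneg_left hst hlam]) le_rfl) hp

namespace IsSol

variable {N : ℕ} {p lam α : ℝ} {ψ : EuclideanSpace ℝ (Fin N) → ℝ}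

theorem neg_laplacian_eq (h : IsSol (DN N) p lam α ψ) {x : EuclideanSpace ℝ (Fin N)}
    (hx : x ∈ ball 0 (RN N)) : -Δ ψ x = (max (α + lam * ψ x) 0) ^ p := by
  rw [← lapl_eq_laplacian h.1]
  exact h.2.1 x hx

theorem eq_zero_of_norm_eq (h : IsSol (DN N) p lam α ψ) {x : EuclideanSpace ℝ (Fin N)}
    (hx : ‖x‖ = RN N) : ψ x = 0 := by
  refine h.2.2.1 x ?_
  rw [DN, frontier_ball _ (RN_pos N).ne']
  simpa using hx

variable [NeZero N]

theorem pos (h : IsSol (DN N) p lam α ψ) : ∀ x ∈ ball 0 (RN N), 0 < ψ x := by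
  have hsup : ∀ x ∈ ball 0 (RN N), Δ ψ x ≤ 0 := fun x hx => by
    have h1 := h.neg_laplacian_eq hx
    have h2 : 0 ≤ (max (α + lam * ψ x) 0) ^ p := Real.rpow_nonneg (le_max_right _ _) _
    linarith
  have hnn := nonneg_of_superharmonic h.1 (RN_pos N) hsup fun x hx => h.eq_zero_of_norm_eq hx
  obtain ⟨z, hz, hψz⟩ : ∃ z ∈ ball 0 (RN N), 0 < ψ z := by
    by_contra! hle
    have hz : ∀ x ∈ ball 0 (RN N), ψ x = 0 := fun x hx =>
      le_antisymm (hle x hx) (hnn x (ball_subset_closedBall hx))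
    have hint := h.2.2.2
    rw [DN, setIntegral_congr_fun (g := fun _ => (0 : ℝ)) measurableSet_ball] at hint
    · simp at hint
    · intro x hx
      have hev : ψ =ᶠ[𝓝 x] fun _ => 0 := by
        filter_upwards [isOpen_ball.mem_nhds hx] with y hy using hz y hy
      have h1 : Δ ψ x = 0 := by
        rw [(InnerProductSpace.laplacian_congr_nhds hev).eq_of_nhds]
        simp [laplacian_eq_sum_fderiv (EuclideanSpace.basisFun (Fin N) ℝ)]
      have h2 := h.neg_laplacian_eq hx
      simp only
      rw [← h2, h1, neg_zero]
  exact pos_of_superharmonic h.1 isOpen_ball (convex_ball _ _).isPreconnected hsup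
    (fun x hx => hnn x (ball_subset_closedBall hx)) hz hψz

theorem eq_of_norm_eq (h : IsSol (DN N) p lam α ψ) (hp : 0 ≤ p) (hlam : 0 ≤ lam)
    {x y : EuclideanSpace ℝ (Fin N)} (hx : ‖x‖ ≤ RN N) (hxy : ‖x‖ = ‖y‖) : ψ x = ψ y :=
  _root_.eq_of_norm_eq h.1 (RN_pos N) (monotone_max_affine_rpow hp hlam)
    (fun _ => Real.rpow_nonneg (le_max_right _ _) _) (fun _ hx => h.neg_laplacian_eq hx)
    (fun _ hx => h.eq_zero_of_norm_eq hx) h.pos hx hxy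

theorem eq_one_of_zero (h : IsSol (DN N) p 0 α ψ) (hp : 0 < p) : α = 1 := by
  have h1 := h.2.2.2
  simp only [zero_mul, add_zero, setIntegral_const, volume_real_DN, one_smul] at h1
  have h2 : max α 0 = 1 := by
    rw [← Real.one_rpow p] at h1
    exact (Real.rpow_left_inj (le_max_right _ _) zero_le_one hp.ne').1 h1
  rcases max_choice α 0 with h3 | h3 <;> rw [h3] at h2
  · exact h2
  · norm_num at h2

theorem lt_one (h : IsSol (DN N) p lam α ψ) (hp : 0 < p) (hlam : 0 < lam) : α < 1 := by
  by_contra! hα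
  have hgt : ∀ x ∈ DN N, 1 < (max (α + lam * ψ x) 0) ^ p := fun x hx =>
    Real.one_lt_rpow (lt_max_of_lt_left (by nlinarith [mul_pos hlam (h.pos x hx)])) hp
  have hfin : volume (DN N) ≠ ⊤ := measure_ball_lt_top.ne
  have hcont : Continuous fun x => (max (α + lam * ψ x) 0) ^ p :=
    ((continuous_const.add (continuous_const.mul h.1.continuous)).max continuous_const).rpow_const
      fun _ => Or.inr hp.le
  have hi : IntegrableOn (fun x => (max (α + lam * ψ x) 0) ^ p) (DN N) :=
    (hcont.continuousOn.integrableOn_compact (isCompact_closedBall 0 (RN N))).mono_set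
      ball_subset_closedBall
  have hpos : 0 < ∫ x in DN N, ((max (α + lam * ψ x) 0) ^ p - 1) := by
    rw [setIntegral_pos_iff_support_of_nonneg_ae]
    · refine lt_of_lt_of_le ?_ (measure_mono (s := DN N) fun x hx =>
        ⟨(sub_pos.2 (hgt x hx)).ne', hx⟩)
      exact measure_ball_pos _ _ (RN_pos N)
    · filter_upwards [ae_restrict_mem measurableSet_ball] with x hx
      exact (sub_pos.2 (hgt x hx)).le
    · exact hi.sub (integrableOn_const hfin)
  rw [integral_sub hi (integrableOn_const hfin), h.2.2.2, setIntegral_const, volume_real_DN] at hpos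
  norm_num at hpos

theorem exists_profile (h : IsSol (DN N) p lam α ψ) (hN : 2 ≤ N) (hp : 1 < p) (hlam : 0 < lam) :
    ∃ (T : ℝ) (U V : ℝ → ℝ), 0 < T ∧ IsRadialSol (N - 1) p 1 T U V ∧ U 0 = 1 ∧
      α * (N : ℝ) ^ (1 / p) = U T * (T / -V T) ^ (1 / p) ∧
      T ^ (p + 1) * (-V T) ^ (p - 1) = (lam * RN N ^ 2 / N) ^ (p - 1) * (lam * RN N ^ 2) := by
  have hp0 : 0 < p := one_pos.trans hp
  have hR := RN_pos N
  have hN0 : (0 : ℝ) < N := by exact_mod_cast (by omega : 0 < N)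
  have hd : 1 ≤ N - 1 := by omega
  set b := EuclideanSpace.basisFun (Fin N) ℝ
  have hrs := isRadialSol_of_radial b 0 h.1 hR (fun x y => h.eq_of_norm_eq hp0.le hlam.le)
    fun x hx => h.neg_laplacian_eq hx
  rw [Fintype.card_fin] at hrs
  set u : ℝ → ℝ := fun r => α + lam * ψ (r • b 0) with hu
  set v : ℝ → ℝ := fun r => lam * fderiv ℝ ψ (r • b 0) (b 0)
  have hnb : ∀ t : ℝ, 0 ≤ t → ‖t • b 0‖ = t := fun t ht => by
    rw [norm_smul, b.orthonormal.1 0, mul_one, Real.norm_of_nonneg ht]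
  have huR : u (RN N) = α := by
    simp [hu, h.eq_zero_of_norm_eq (hnb _ hR.le)]
  have hmass : N * (volume.real (ball (0 : EuclideanSpace ℝ (Fin N)) 1) *
      ∫ t in (0 : ℝ)..RN N, t ^ (N - 1) * (max (u t) 0) ^ p) = 1 := by
    refine Eq.trans (setIntegral_ball_radial (F := fun x => (max (α + lam * ψ x) 0) ^ p)
      (fun x hx => ?_) hR.le).symm h.2.2.2
    rw [hu]
    simp only
    rw [h.eq_of_norm_eq hp0.le hlam.le (mem_ball_zero_iff.1 hx).le
      (hnb _ (norm_nonneg x)).symm]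
  have hω := volume_real_unit_ball_mul_RN_pow N
  have hω0 := volume_real_unit_ball_pos N
  set ω := volume.real (ball (0 : EuclideanSpace ℝ (Fin N)) 1)
  set I := ∫ t in (0 : ℝ)..RN N, t ^ (N - 1) * (max (u t) 0) ^ p with hI
  have hIval : N * I = RN N ^ N := by
    refine mul_left_cancel₀ hω0.ne' ?_
    rw [hω, ← hmass]
    ring
  have hflux : RN N ^ (N - 1) * v (RN N) = -(lam * I) := by
    have hc : Continuous fun t => -(lam * (t ^ (N - 1) * (max (u t) 0) ^ p)) := by
      have : Continuous fun t => (max (u t) 0) ^ p :=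
        (hrs.continuous.max continuous_const).rpow_const fun _ => Or.inr hp0.le
      fun_prop
    have h1 := intervalIntegral.integral_eq_sub_of_hasDerivAt_of_le hR.le
      hrs.continuous_flux.continuousOn (fun t ht => hrs.hasDerivAt_flux hd ht)
      (hc.intervalIntegrable _ _)
    rw [intervalIntegral.integral_neg, intervalIntegral.integral_const_mul, hrs.deriv_zero,
      mul_zero, sub_zero] at h1
    exact h1.symm
  have hvR : v (RN N) = -(lam * RN N / N) := by
    have h1 : RN N ^ N = RN N ^ (N - 1) * RN N := by
      rw [← pow_succ, Nat.sub_add_cancel (by omega)]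
    have h2 : 0 < RN N ^ (N - 1) := pow_pos hR _
    refine mul_left_cancel₀ h2.ne' ?_
    rw [hflux, show I = RN N ^ N / N by rw [← hIval]; field_simp, h1]
    ring
  set m := u 0 with hm_def
  have hm : 0 < m := by
    by_contra! hm
    have h1 : I = 0 := by
      rw [hI, intervalIntegral.integral_congr (g := fun _ => (0 : ℝ))]
      · simp
      · intro t ht
        rw [uIcc_of_le hR.le] at ht
        have : u t ≤ 0 :=
          (hrs.antitoneOn hd hlam.le ⟨le_rfl, hR.le⟩ ht ht.1).trans hm
        simp [max_eq_right this, Real.zero_rpow hp0.ne']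
    rw [h1, mul_zero] at hIval
    exact (pow_pos hR N).ne hIval
  have hmp : 0 < m ^ (p - 1) := Real.rpow_pos_of_pos hm _
  set s := √(lam * m ^ (p - 1)) with hs_def
  have hs : 0 < s := Real.sqrt_pos.2 (mul_pos hlam hmp)
  have hs2 : s ^ 2 = lam * m ^ (p - 1) := Real.sq_sqrt (mul_pos hlam hmp).le
  have hVT : -(v (s * RN N / s) / (m * s)) = lam * RN N / (N * m * s) := by
    rw [mul_div_cancel_left₀ _ hs.ne', hvR]
    field_simp
  refine ⟨s * RN N, _, _, mul_pos hs hR, hrs.rescale hm hs (by rw [hs2, mul_one]), ?_, ?_, ?_⟩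
  · simp only [zero_div]
    exact div_self hm.ne'
  · rw [hVT, mul_div_cancel_left₀ _ hs.ne', huR]
    have h1 : s * RN N / (lam * RN N / (N * m * s)) = N * m ^ p := by
      have : m ^ p = m ^ (p - 1) * m := by rw [Real.rpow_sub hm, Real.rpow_one]; field_simp
      rw [this]
      field_simp
      rw [hs2]
    rw [h1, Real.mul_rpow hN0.le (Real.rpow_nonneg hm.le _), ← Real.rpow_mul hm.le,
      mul_one_div_cancel hp0.ne', Real.rpow_one]
    field_simp
  · rw [hVT]
    have hsR : 0 < s * RN N := mul_pos hs hR
    have h1 : (s * RN N) ^ (p + 1) = (s * RN N) ^ (p - 1) * (s * RN N) ^ 2 := by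
      rw [← Real.rpow_two, ← Real.rpow_add hsR]
      ring_nf
    have h2 : lam * RN N ^ 2 / N = s * RN N * (lam * RN N / (N * m * s)) * m := by
      field_simp
    rw [h1, h2, Real.mul_rpow (by positivity) hm.le, Real.mul_rpow hsR.le (by positivity), mul_pow,
      hs2]
    ring

end IsSol

end Solutions

theorem stmt2 (N : ℕ) (hN : 2 ≤ N) (p : ℝ) (hp1 : 1 < p)
    (hpN : N = 2 ∨ p < (N : ℝ) / ((N : ℝ) - 2))
    (lam₁ lam₂ : ℝ) (hlam₁ : 0 ≤ lam₁) (hlt : lam₁ < lam₂)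
    (α₁ α₂ : ℝ) (ψ₁ ψ₂ : EuclideanSpace ℝ (Fin N) → ℝ)
    (hsol₁ : IsSol (DN N) p lam₁ α₁ ψ₁) (hsol₂ : IsSol (DN N) p lam₂ α₂ ψ₂) :
    α₂ < α₁ := by
  have hp0 : 0 < p := one_pos.trans hp1
  have : NeZero N := ⟨by omega⟩
  have hlam₂ : 0 < lam₂ := hlam₁.trans_lt hlt
  rcases hlam₁.eq_or_lt with rfl | hlam₁
  · rw [hsol₁.eq_one_of_zero hp0]
    exact hsol₂.lt_one hp0 hlam₂
  have hd : 1 ≤ N - 1 := by omega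
  have hN0 : (0 : ℝ) < N := by exact_mod_cast (by omega : 0 < N)
  have hpd : p * (((N - 1 : ℕ) : ℝ) - 1) < ((N - 1 : ℕ) : ℝ) + 1 := by
    rw [Nat.cast_sub (by omega), Nat.cast_one]
    by_cases hN2 : N = 2
    · subst hN2
      norm_num
    · have h3 : (3 : ℝ) ≤ N := by exact_mod_cast (by omega : 3 ≤ N)
      have h4 := (lt_div_iff₀ (by linarith)).1 (hpN.resolve_left hN2)
      linarith
  obtain ⟨T₁, U₁, V₁, hT₁, hU₁, hU₁0, hα₁, hl₁⟩ := hsol₁.exists_profile hN hp1 hlam₁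
  obtain ⟨T₂, U₂, V₂, hT₂, hU₂, hU₂0, hα₂, hl₂⟩ := hsol₂.exists_profile hN hp1 hlam₂
  have hR := RN_pos N
  have hlt' : T₁ ^ (p + 1) * (-V₁ T₁) ^ (p - 1) < T₂ ^ (p + 1) * (-V₂ T₂) ^ (p - 1) := by
    rw [hl₁, hl₂]
    have h1 : lam₁ * RN N ^ 2 < lam₂ * RN N ^ 2 := mul_lt_mul_of_pos_right hlt (by positivity)
    exact mul_lt_mul'' (Real.rpow_lt_rpow (by positivity)
      (div_lt_div_of_pos_right h1 hN0) (by linarith)) h1 (by positivity) (by positivity)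
  have hTlt : T₁ < T₂ := by
    by_contra! hle
    have hV := (hU₂.eq_of_zero_eq_one hd hp1 (hU₁.mono hle) hU₂0 hU₁0 ⟨hT₂.le, le_rfl⟩).2
    rw [hV] at hlt'
    rcases hle.eq_or_lt with rfl | hlt''
    · exact lt_irrefl _ hlt'
    · exact lt_asymm hlt' (hU₁.rpow_mul_deriv_rpow_lt hd hp1 hpd (by simp [hU₁0]) hT₂ hlt'' le_rfl)
  obtain ⟨hU, hV⟩ := hU₁.eq_of_zero_eq_one hd hp1 (hU₂.mono hTlt.le) hU₁0 hU₂0 ⟨hT₁.le, le_rfl⟩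
  have hfin := hU₂.mul_rpow_lt hd hp1 hpd (by simp [hU₂0]) hT₁ hTlt
  rw [← hU, ← hV, ← hα₁, ← hα₂] at hfin
  exact lt_of_mul_lt_mul_right hfin (by positivity)

end
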